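/- arXiv:2405.20023 — 12 statements merged into one kernel-verified Lean document; each statement's English description precedes it below -/
import Mathlib

section
/- With Γ = (XᵀX)⁻¹XᵀΩX(XᵀX)⁻¹, Ξ = (XᵀX)⁻¹XᵀΩZ(ZᵀZ)⁻¹ and Δ = (ZᵀZ)⁻¹ZᵀΩZ(ZᵀZ)⁻¹, one has the representation Ω = XΓXᵀ + XΞZᵀ + ZΞᵀXᵀ + ZΔZᵀ, and moreover Γ and Δ are symmetric positive definite. -/
open Matrix

theorem aux_unit {n m : ℕ} (X : Matrix (Fin n) (Fin m) ℝ) (hX : X.rank = m) :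
    (Xᵀ * X)⁻¹ * Xᵀ * X = 1 := by
  have h : IsUnit (Xᵀ * X) := by
    rw [← Matrix.mulVec_surjective_iff_isUnit]
    have hr : (Xᵀ * X).rank = m := by rw [Matrix.rank_transpose_mul_self, hX]
    have ht : LinearMap.range (Xᵀ * X).mulVecLin = ⊤ := by
      apply Submodule.eq_top_of_finrank_eq
      rw [Module.finrank_fin_fun]
      exact hr
    exact LinearMap.range_eq_top.1 ht
  rw [Matrix.mul_assoc]
  exact Matrix.nonsing_inv_mul _ ((Matrix.isUnit_iff_isUnit_det _).1 h)

theorem aux_pd {n m : ℕ} (X : Matrix (Fin n) (Fin m) ℝ) (A : Matrix (Fin m) (Fin n) ℝ)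
    (h : A * X = 1) (Ω : Matrix (Fin n) (Fin n) ℝ) (hΩ : Ω.PosDef) : (A * Ω * Aᵀ).PosDef := by
  have h' : Xᵀ * Aᵀ = 1 := by rw [← Matrix.transpose_mul, h, Matrix.transpose_one]
  have := hΩ.conjTranspose_mul_mul_same (B := Aᵀ) (by
    intro v w hvw
    have := congrArg (fun u => Xᵀ *ᵥ u) hvw
    simpa [Matrix.mulVec_mulVec, h'] using this)
  simpa [Matrix.conjTranspose_eq_transpose_of_trivial] using this

theorem stmt_0 (n k : ℕ) (hk : 0 < k) (hn : k < n)
    (X : Matrix (Fin n) (Fin k) ℝ) (hX : X.rank = k)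
    (Z : Matrix (Fin n) (Fin (n - k)) ℝ) (hXZ : Xᵀ * Z = 0) (hZ : Z.rank = n - k)
    (Ω : Matrix (Fin n) (Fin n) ℝ) (hΩ : Ω.PosDef)
    (Γ : Matrix (Fin k) (Fin k) ℝ) (hΓ : Γ = (Xᵀ * X)⁻¹ * Xᵀ * Ω * X * (Xᵀ * X)⁻¹)
    (Ξ : Matrix (Fin k) (Fin (n - k)) ℝ) (hΞ : Ξ = (Xᵀ * X)⁻¹ * Xᵀ * Ω * Z * (Zᵀ * Z)⁻¹)
    (Δ : Matrix (Fin (n - k)) (Fin (n - k)) ℝ)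
    (hΔ : Δ = (Zᵀ * Z)⁻¹ * Zᵀ * Ω * Z * (Zᵀ * Z)⁻¹) :
    Ω = X * Γ * Xᵀ + X * Ξ * Zᵀ + Z * Ξᵀ * Xᵀ + Z * Δ * Zᵀ ∧ Γ.PosDef ∧ Δ.PosDef := by
  have hAX := aux_unit X hX
  have hBZ := aux_unit Z hZ
  have hZX : Zᵀ * X = 0 := by
    have := congrArg Matrix.transpose hXZ
    simpa using this
  have hAt : ((Xᵀ * X)⁻¹ * Xᵀ)ᵀ = X * (Xᵀ * X)⁻¹ := by
    simp [Matrix.transpose_mul, Matrix.transpose_nonsing_inv]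
  have hBt : ((Zᵀ * Z)⁻¹ * Zᵀ)ᵀ = Z * (Zᵀ * Z)⁻¹ := by
    simp [Matrix.transpose_mul, Matrix.transpose_nonsing_inv]
  have hAZ : (Xᵀ * X)⁻¹ * Xᵀ * Z = 0 := by rw [Matrix.mul_assoc, hXZ, Matrix.mul_zero]
  have hBX : (Zᵀ * Z)⁻¹ * Zᵀ * X = 0 := by rw [Matrix.mul_assoc, hZX, Matrix.mul_zero]
  have hΓ' : Γ = ((Xᵀ * X)⁻¹ * Xᵀ) * Ω * ((Xᵀ * X)⁻¹ * Xᵀ)ᵀ := by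
    rw [hΓ, hAt]; simp only [Matrix.mul_assoc]
  have hΞ' : Ξ = ((Xᵀ * X)⁻¹ * Xᵀ) * Ω * ((Zᵀ * Z)⁻¹ * Zᵀ)ᵀ := by
    rw [hΞ, hBt]; simp only [Matrix.mul_assoc]
  have hΔ' : Δ = ((Zᵀ * Z)⁻¹ * Zᵀ) * Ω * ((Zᵀ * Z)⁻¹ * Zᵀ)ᵀ := by
    rw [hΔ, hBt]; simp only [Matrix.mul_assoc]
  clear hΓ hΞ hΔ hAt hBt
  generalize (Xᵀ * X)⁻¹ * Xᵀ = A at *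
  generalize (Zᵀ * Z)⁻¹ * Zᵀ = B at *
  have hS : Ωᵀ = Ω := by
    have := hΩ.isHermitian.eq
    rwa [Matrix.conjTranspose_eq_transpose_of_trivial] at this
  have hI : X * A + Z * B = 1 := by
    have h1 : Matrix.fromRows A B * Matrix.fromCols X Z = 1 := by
      rw [Matrix.fromRows_mul_fromCols, hAX, hAZ, hBX, hBZ, Matrix.fromBlocks_one]
    have h2 := (Matrix.mul_eq_one_comm_of_card_eq (Fin k ⊕ Fin (n - k)) (Fin n) ℝ
      (by rw [Fintype.card_sum, Fintype.card_fin, Fintype.card_fin, Fintype.card_fin]; omega)).1 h1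
    rwa [Matrix.fromCols_mul_fromRows] at h2
  refine ⟨?_, hΓ' ▸ aux_pd X A hAX Ω hΩ, hΔ' ▸ aux_pd Z B hBZ Ω hΩ⟩
  calc Ω = (X * A + Z * B) * Ω * (X * A + Z * B)ᵀ := by rw [hI]; simp
    _ = _ := by
      rw [hΓ', hΞ', hΔ']
      simp only [Matrix.transpose_add, Matrix.transpose_mul, Matrix.transpose_transpose, hS,
        Matrix.add_mul, Matrix.mul_add, Matrix.mul_assoc]
      abel
end

section
/- The equality RSS(Ω,0)(y) = RSS(I_n,0)(y) holds for every y ∈ ℝⁿ if and only if Δ = (ZᵀZ)⁻¹, where Δ = (ZᵀZ)⁻¹ZᵀΩZ(ZᵀZ)⁻¹ (equivalently, if and only if ZᵀΩZ = ZᵀZ). -/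
open Matrix

/-- The general ridge estimator `β̂(Φ,K) y = (XᵀΦ⁻¹X + K)⁻¹ XᵀΦ⁻¹ y`. -/
noncomputable def ridge {n k : ℕ} (X : Matrix (Fin n) (Fin k) ℝ)
    (Φ : Matrix (Fin n) (Fin n) ℝ) (K : Matrix (Fin k) (Fin k) ℝ)
    (y : Fin n → ℝ) : Fin k → ℝ :=
  ((Xᵀ * Φ⁻¹ * X + K)⁻¹ * Xᵀ * Φ⁻¹).mulVec y

/-- The residual sum of squares `RSS(Φ,K)(y) = (y − Xβ̂)ᵀ Φ⁻¹ (y − Xβ̂)`. -/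
noncomputable def RSS {n k : ℕ} (X : Matrix (Fin n) (Fin k) ℝ)
    (Φ : Matrix (Fin n) (Fin n) ℝ) (K : Matrix (Fin k) (Fin k) ℝ)
    (y : Fin n → ℝ) : ℝ :=
  (y - X.mulVec (ridge X Φ K y)) ⬝ᵥ Φ⁻¹.mulVec (y - X.mulVec (ridge X Φ K y))

/- HELPERS -/
theorem inj_of_rank {n m : ℕ} (X : Matrix (Fin n) (Fin m) ℝ) (hX : X.rank = m) :
    Function.Injective X.mulVec := by
  have h := LinearMap.finrank_range_add_finrank_ker X.mulVecLin
  have h2 : Module.finrank ℝ (LinearMap.range X.mulVecLin) = m := hX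
  rw [h2, Module.finrank_fin_fun] at h
  have h3 : Module.finrank ℝ (LinearMap.ker X.mulVecLin) = 0 := by omega
  have h4 := Submodule.finrank_eq_zero.mp h3
  exact LinearMap.ker_eq_bot.mp h4

theorem posDef_sandwich {n m : ℕ} (X : Matrix (Fin n) (Fin m) ℝ) (hX : X.rank = m)
    (A : Matrix (Fin n) (Fin n) ℝ) (hA : A.PosDef) : (Xᵀ * A * X).PosDef := by
  have := hA.conjTranspose_mul_mul_same (inj_of_rank X hX)
  rwa [conjTranspose_eq_transpose_of_trivial] at this

theorem mem_range_of {n k : ℕ} (hn : k < n)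
    (X : Matrix (Fin n) (Fin k) ℝ) (hX : X.rank = k)
    (Z : Matrix (Fin n) (Fin (n - k)) ℝ) (hZX : Zᵀ * X = 0) (hZ : Z.rank = n - k)
    (d : Fin n → ℝ) (hd : Zᵀ *ᵥ d = 0) : ∃ b, X *ᵥ b = d := by
  have hle : LinearMap.range X.mulVecLin ≤ LinearMap.ker Zᵀ.mulVecLin := by
    rintro _ ⟨b, rfl⟩
    rw [LinearMap.mem_ker, mulVecLin_apply, mulVecLin_apply, mulVec_mulVec, hZX, zero_mulVec]
  have h1 : Module.finrank ℝ (LinearMap.range X.mulVecLin) = k := hX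
  have h2 : Module.finrank ℝ (LinearMap.range Zᵀ.mulVecLin) = n - k := by
    have := Matrix.rank_transpose Z
    rw [hZ] at this
    exact this
  have h := LinearMap.finrank_range_add_finrank_ker Zᵀ.mulVecLin
  rw [h2, Module.finrank_fin_fun] at h
  have he := Submodule.eq_of_le_of_finrank_eq hle (by omega)
  have : d ∈ LinearMap.range X.mulVecLin := by
    rw [he, LinearMap.mem_ker, mulVecLin_apply, hd]
  obtain ⟨b, hb⟩ := this
  exact ⟨b, by simpa using hb⟩

theorem resid_eq {n k : ℕ} (hn : k < n)
    (X : Matrix (Fin n) (Fin k) ℝ) (hX : X.rank = k)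
    (Z : Matrix (Fin n) (Fin (n - k)) ℝ) (hXZ : Xᵀ * Z = 0) (hZ : Z.rank = n - k)
    (Φ : Matrix (Fin n) (Fin n) ℝ) (hΦ : Φ.PosDef) (y : Fin n → ℝ) :
    y - X *ᵥ (ridge X Φ 0 y) = Φ *ᵥ (Z *ᵥ ((Zᵀ * Φ * Z)⁻¹ *ᵥ (Zᵀ *ᵥ y))) := by
  have hZX : Zᵀ * X = 0 := by
    have := congrArg Matrix.transpose hXZ
    simpa using this
  have hP := posDef_sandwich X hX Φ⁻¹ hΦ.inv
  have hS := posDef_sandwich Z hZ Φ hΦ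
  have uP := (Matrix.isUnit_iff_isUnit_det _).mp hP.isUnit
  have uS := (Matrix.isUnit_iff_isUnit_det _).mp hS.isUnit
  have uΦ := (Matrix.isUnit_iff_isUnit_det _).mp hΦ.isUnit
  have e1 : Xᵀ *ᵥ (Φ⁻¹ *ᵥ (y - X *ᵥ (ridge X Φ 0 y))) = 0 := by
    have : (Xᵀ * Φ⁻¹ * X) * ((Xᵀ * Φ⁻¹ * X)⁻¹ * Xᵀ * Φ⁻¹) = Xᵀ * Φ⁻¹ := by
      rw [Matrix.mul_assoc _ Xᵀ, Matrix.mul_nonsing_inv_cancel_left _ _ uP]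
    unfold ridge
    rw [add_zero, mulVec_sub, mulVec_sub, sub_eq_zero]
    rw [mulVec_mulVec, mulVec_mulVec, mulVec_mulVec, mulVec_mulVec, this]
  have e2 : Xᵀ *ᵥ (Φ⁻¹ *ᵥ (Φ *ᵥ (Z *ᵥ ((Zᵀ * Φ * Z)⁻¹ *ᵥ (Zᵀ *ᵥ y))))) = 0 := by
    rw [mulVec_mulVec _ Φ⁻¹, Matrix.nonsing_inv_mul _ uΦ, one_mulVec, mulVec_mulVec, hXZ,
      zero_mulVec]
  have e3 : Zᵀ *ᵥ (y - X *ᵥ (ridge X Φ 0 y)) = Zᵀ *ᵥ y := by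
    rw [mulVec_sub, mulVec_mulVec, hZX, zero_mulVec, sub_zero]
  have e4 : Zᵀ *ᵥ (Φ *ᵥ (Z *ᵥ ((Zᵀ * Φ * Z)⁻¹ *ᵥ (Zᵀ *ᵥ y)))) = Zᵀ *ᵥ y := by
    rw [mulVec_mulVec, mulVec_mulVec, mulVec_mulVec, Matrix.mul_nonsing_inv _ uS, one_mulVec]
  rw [← sub_eq_zero]
  generalize y - X *ᵥ (ridge X Φ 0 y) = u at *
  generalize Φ *ᵥ (Z *ᵥ ((Zᵀ * Φ * Z)⁻¹ *ᵥ (Zᵀ *ᵥ y))) = v at *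
  obtain ⟨b, hb⟩ := mem_range_of hn X hX Z hZX hZ (u - v) (by rw [mulVec_sub, e3, e4, sub_self])
  have h0 : (Xᵀ * Φ⁻¹ * X) *ᵥ b = 0 := by
    rw [← mulVec_mulVec, hb, ← mulVec_mulVec, mulVec_sub, mulVec_sub, e1, e2, sub_self]
  have hb0 : b = 0 := by
    have := congrArg ((Xᵀ * Φ⁻¹ * X)⁻¹ *ᵥ ·) h0
    simpa [mulVec_mulVec, Matrix.nonsing_inv_mul _ uP] using this
  rw [← hb, hb0, mulVec_zero]

theorem RSS_eq {n k : ℕ} (hn : k < n)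
    (X : Matrix (Fin n) (Fin k) ℝ) (hX : X.rank = k)
    (Z : Matrix (Fin n) (Fin (n - k)) ℝ) (hXZ : Xᵀ * Z = 0) (hZ : Z.rank = n - k)
    (Φ : Matrix (Fin n) (Fin n) ℝ) (hΦ : Φ.PosDef) (y : Fin n → ℝ) :
    RSS X Φ 0 y = (Zᵀ *ᵥ y) ⬝ᵥ ((Zᵀ * Φ * Z)⁻¹ *ᵥ (Zᵀ *ᵥ y)) := by
  have hS := posDef_sandwich Z hZ Φ hΦ
  have uS := (Matrix.isUnit_iff_isUnit_det _).mp hS.isUnit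
  have uΦ := (Matrix.isUnit_iff_isUnit_det _).mp hΦ.isUnit
  unfold RSS
  rw [resid_eq hn X hX Z hXZ hZ Φ hΦ y]
  rw [mulVec_mulVec _ Φ⁻¹, Matrix.nonsing_inv_mul _ uΦ, one_mulVec]
  rw [dotProduct_mulVec, ← mulVec_transpose, mulVec_mulVec, mulVec_mulVec, mulVec_mulVec,
    Matrix.mul_nonsing_inv _ uS, one_mulVec]

theorem stmt_2 (n k : ℕ) (hk : 0 < k) (hn : k < n)
    (X : Matrix (Fin n) (Fin k) ℝ) (hX : X.rank = k)
    (Z : Matrix (Fin n) (Fin (n - k)) ℝ) (hXZ : Xᵀ * Z = 0) (hZ : Z.rank = n - k)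
    (Ω : Matrix (Fin n) (Fin n) ℝ) (hΩ : Ω.PosDef)
    (Δ : Matrix (Fin (n - k)) (Fin (n - k)) ℝ)
    (hΔ : Δ = (Zᵀ * Z)⁻¹ * Zᵀ * Ω * Z * (Zᵀ * Z)⁻¹) :
    ((∀ y : Fin n → ℝ, RSS X Ω 0 y = RSS X 1 0 y) ↔ Δ = (Zᵀ * Z)⁻¹) ∧
      ((∀ y : Fin n → ℝ, RSS X Ω 0 y = RSS X 1 0 y) ↔ Zᵀ * Ω * Z = Zᵀ * Z) := by
  have hS := posDef_sandwich Z hZ Ω hΩ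
  have hT : (Zᵀ * Z).PosDef := by
    simpa using posDef_sandwich Z hZ 1 Matrix.PosDef.one
  have uS := (Matrix.isUnit_iff_isUnit_det _).mp hS.isUnit
  have uT := (Matrix.isUnit_iff_isUnit_det _).mp hT.isUnit
  have key : (∀ y : Fin n → ℝ, RSS X Ω 0 y = RSS X 1 0 y) ↔ Zᵀ * Ω * Z = Zᵀ * Z := by
    simp only [RSS_eq hn X hX Z hXZ hZ Ω hΩ, RSS_eq hn X hX Z hXZ hZ 1 Matrix.PosDef.one,
      Matrix.mul_one]
    constructor
    · intro h
      have hw : ∀ w, w ⬝ᵥ (((Zᵀ * Ω * Z)⁻¹ - (Zᵀ * Z)⁻¹) *ᵥ w) = 0 := by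
        intro w
        have := h (Z *ᵥ ((Zᵀ * Z)⁻¹ *ᵥ w))
        rw [mulVec_mulVec _ Zᵀ, mulVec_mulVec _ (Zᵀ * Z), Matrix.mul_nonsing_inv _ uT,
          one_mulVec] at this
        rw [sub_mulVec, dotProduct_sub, this, sub_self]
      have hD : ((Zᵀ * Ω * Z)⁻¹ - (Zᵀ * Z)⁻¹).PosSemidef := by
        refine Matrix.PosSemidef.of_dotProduct_mulVec_nonneg
          (hS.inv.isHermitian.sub hT.inv.isHermitian) ?_
        intro w
        rw [star_trivial, hw]
      have h0 : (Zᵀ * Ω * Z)⁻¹ - (Zᵀ * Z)⁻¹ = 0 := by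
        apply Matrix.ext_of_mulVec_single
        intro i
        rw [zero_mulVec]
        exact (hD.dotProduct_mulVec_zero_iff _).mp (by rw [star_trivial, hw])
      exact Matrix.inv_inj (sub_eq_zero.mp h0) uS
    · intro h y
      rw [h]
  refine ⟨key.trans ?_, key⟩
  rw [hΔ]
  constructor
  · intro h
    rw [Matrix.mul_assoc _ Zᵀ, Matrix.mul_assoc _ (Zᵀ * Ω), h, Matrix.nonsing_inv_mul _ uT,
      Matrix.one_mul]
  · intro h
    have h2 := congrArg (fun M => (Zᵀ * Z) * M * (Zᵀ * Z)) h
    rw [Matrix.mul_nonsing_inv _ uT, Matrix.one_mul, Matrix.mul_assoc _ Zᵀ,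
      Matrix.mul_assoc _ (Zᵀ * Ω), Matrix.mul_assoc (Zᵀ * Z)⁻¹,
      Matrix.mul_nonsing_inv_cancel_left _ _ uT, Matrix.nonsing_inv_mul_cancel_right _ _ uT] at h2
    exact h2
end

section
/- There exists a real symmetric n×n matrix Λ such that Ω = N + Λ − NΛN if and only if Δ = (ZᵀZ)⁻¹, where Δ = (ZᵀZ)⁻¹ZᵀΩZ(ZᵀZ)⁻¹. -/
open Matrix

lemma aux_unit_s3 {n m : ℕ} (Z : Matrix (Fin n) (Fin m) ℝ) (hZ : Z.rank = m) :
    IsUnit (Zᵀ * Z).det := by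
  have h : (Zᵀ * Z).rank = m := by rw [Matrix.rank_transpose_mul_self, hZ]
  rw [← Matrix.isUnit_iff_isUnit_det, ← Matrix.linearIndependent_cols_iff_isUnit,
    linearIndependent_iff_card_eq_finrank_span]
  rw [Matrix.rank_eq_finrank_span_cols] at h
  simpa [Set.finrank] using h.symm

theorem stmt_3 (n k : ℕ) (hk : 0 < k) (hn : k < n)
    (X : Matrix (Fin n) (Fin k) ℝ) (hX : X.rank = k)
    (Z : Matrix (Fin n) (Fin (n - k)) ℝ) (hXZ : Xᵀ * Z = 0) (hZ : Z.rank = n - k)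
    (Ω : Matrix (Fin n) (Fin n) ℝ) (hΩ : Ω.PosDef)
    (N : Matrix (Fin n) (Fin n) ℝ) (hN : N = 1 - X * (Xᵀ * X)⁻¹ * Xᵀ)
    (Δ : Matrix (Fin (n - k)) (Fin (n - k)) ℝ)
    (hΔ : Δ = (Zᵀ * Z)⁻¹ * Zᵀ * Ω * Z * (Zᵀ * Z)⁻¹) :
    (∃ Λ : Matrix (Fin n) (Fin n) ℝ, Λ.IsSymm ∧ Ω = N + Λ - N * Λ * N) ↔
      Δ = (Zᵀ * Z)⁻¹ := by
  have uX := aux_unit_s3 X hX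
  have uZ := aux_unit_s3 Z hZ
  have hZX : Zᵀ * X = 0 := by
    have := congrArg Matrix.transpose hXZ
    simpa using this
  have hNZ : N * Z = Z := by
    rw [hN, Matrix.sub_mul, Matrix.mul_assoc, hXZ]; simp
  have hZN : Zᵀ * N = Zᵀ := by
    rw [hN, Matrix.mul_sub, ← Matrix.mul_assoc, ← Matrix.mul_assoc, hZX]; simp
  constructor
  · rintro ⟨L, -, h⟩
    have h1 : Zᵀ * Ω * Z = Zᵀ * Z := by
      have e : Zᵀ * (N * L * N) * Z = Zᵀ * L * Z := by
        calc Zᵀ * (N * L * N) * Z = (Zᵀ * N) * L * (N * Z) := by simp only [Matrix.mul_assoc]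
          _ = _ := by rw [hZN, hNZ]
      rw [h, Matrix.mul_sub, Matrix.sub_mul, e, Matrix.mul_add, Matrix.add_mul, hZN]
      simp
    have : Δ = (Zᵀ * Z)⁻¹ * (Zᵀ * Ω * Z) * (Zᵀ * Z)⁻¹ := by
      rw [hΔ]; simp only [Matrix.mul_assoc]
    rw [this, h1, Matrix.nonsing_inv_mul _ uZ, Matrix.one_mul]
  · intro h
    have hP : N = Z * (Zᵀ * Z)⁻¹ * Zᵀ := by
      set P := Z * (Zᵀ * Z)⁻¹ * Zᵀ with hPd
      have NT : Nᵀ = N := by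
        rw [hN]
        simp [Matrix.transpose_nonsing_inv, Matrix.mul_assoc]
      have PT : Pᵀ = P := by
        rw [hPd]
        simp [Matrix.transpose_nonsing_inv, Matrix.mul_assoc]
      have NX : N * X = 0 := by
        rw [hN, Matrix.sub_mul, Matrix.mul_assoc, Matrix.mul_assoc,
          Matrix.nonsing_inv_mul _ uX]; simp
      have NN : N * N = N := by
        nth_rewrite 2 [hN]
        rw [Matrix.mul_sub, ← Matrix.mul_assoc, ← Matrix.mul_assoc, NX]; simp
      have NP : N * P = P := by
        rw [hPd, ← Matrix.mul_assoc, ← Matrix.mul_assoc, hNZ]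
      have PN : P * N = P := by
        rw [hPd, Matrix.mul_assoc, hZN]
      have PP : P * P = P := by
        nth_rewrite 2 [hPd]
        rw [← Matrix.mul_assoc, ← Matrix.mul_assoc]
        have : P * Z = Z := by
          rw [hPd, Matrix.mul_assoc, Matrix.mul_assoc, Matrix.nonsing_inv_mul _ uZ,
            Matrix.mul_one]
        rw [this]
      have tP : P.trace = ((n - k : ℕ) : ℝ) := by
        rw [hPd, Matrix.trace_mul_comm, ← Matrix.mul_assoc, Matrix.mul_nonsing_inv _ uZ]
        simp
      have tN : N.trace = ((n - k : ℕ) : ℝ) := by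
        rw [hN, Matrix.trace_sub, Matrix.trace_mul_comm (X * _), ← Matrix.mul_assoc,
          Matrix.mul_nonsing_inv _ uX]
        simp [Nat.cast_sub hn.le]
      have : ((N - P)ᴴ * (N - P)).trace = 0 := by
        rw [Matrix.conjTranspose_eq_transpose_of_trivial, Matrix.transpose_sub, NT, PT,
          Matrix.sub_mul, Matrix.mul_sub, Matrix.mul_sub, NN, NP, PN, PP]
        simp [tP, tN]
      rw [Matrix.trace_conjTranspose_mul_self_eq_zero_iff] at this
      exact sub_eq_zero.mp this
    refine ⟨Ω, ?_, ?_⟩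
    · have := hΩ.isHermitian
      rwa [Matrix.IsHermitian, Matrix.conjTranspose_eq_transpose_of_trivial] at this
    · have : N * Ω * N = N := by
        calc N * Ω * N = Z * Δ * Zᵀ := by
              rw [hP, hΔ]; simp only [Matrix.mul_assoc]
          _ = N := by rw [h, ← hP]
      rw [this]; abel
end

section
/- Let K₁ and K₂ be real k×k symmetric positive semidefinite matrices. Then β̂(Ω,K₁)y = β̂(I_n,K₂)y for every y ∈ ℝⁿ if and only if there exists a real k×k matrix G such that X = ΩXG and K₁ = K₂G. -/
open Matrix

theorem stmt_4 (n k : ℕ) (hk : 0 < k) (hn : k < n)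
    (X : Matrix (Fin n) (Fin k) ℝ) (hX : X.rank = k)
    (Z : Matrix (Fin n) (Fin (n - k)) ℝ) (hXZ : Xᵀ * Z = 0) (hZ : Z.rank = n - k)
    (Ω : Matrix (Fin n) (Fin n) ℝ) (hΩ : Ω.PosDef)
    (K₁ K₂ : Matrix (Fin k) (Fin k) ℝ) (hK₁ : K₁.PosSemidef) (hK₂ : K₂.PosSemidef) :
    (∀ y : Fin n → ℝ, ridge X Ω K₁ y = ridge X 1 K₂ y) ↔
      ∃ G : Matrix (Fin k) (Fin k) ℝ, X = Ω * X * G ∧ K₁ = K₂ * G := by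
  have hinj : Function.Injective X.mulVec := by
    have h : LinearMap.ker X.mulVecLin = ⊥ := by
      have h1 := LinearMap.finrank_range_add_finrank_ker X.mulVecLin
      have h2 : Module.finrank ℝ (LinearMap.range X.mulVecLin) = k := hX
      rw [h2] at h1
      simp at h1
      exact h1
    exact LinearMap.ker_eq_bot.mp h
  have hΩi : (Ω⁻¹).PosDef := hΩ.inv
  have hΩu : IsUnit Ω.det := (Matrix.isUnit_iff_isUnit_det _).mp hΩ.isUnit
  have hΩt : (Ω⁻¹)ᵀ = Ω⁻¹ := by simpa using hΩi.isHermitian.eq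
  have hA : (Xᵀ * Ω⁻¹ * X + K₁).PosDef := by
    have := hΩi.conjTranspose_mul_mul_same hinj
    rw [Matrix.conjTranspose_eq_transpose_of_trivial] at this
    exact this.add_posSemidef hK₁
  have hB : (Xᵀ * X + K₂).PosDef := by
    have := (Matrix.PosDef.one (n := Fin n) (R := ℝ)).conjTranspose_mul_mul_same hinj
    rw [Matrix.conjTranspose_eq_transpose_of_trivial, Matrix.mul_one] at this
    exact this.add_posSemidef hK₂
  have key : (∀ y : Fin n → ℝ, ridge X Ω K₁ y = ridge X 1 K₂ y) ↔
      (Xᵀ * Ω⁻¹ * X + K₁)⁻¹ * (Xᵀ * Ω⁻¹) = (Xᵀ * X + K₂)⁻¹ * Xᵀ := by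
    unfold ridge
    simp only [inv_one, Matrix.mul_one, Matrix.mul_assoc]
    constructor
    · intro h
      exact Matrix.mulVec_injective (funext h)
    · intro h y
      rw [h]
  rw [key]
  have hBt : ((Xᵀ * X + K₂)⁻¹)ᵀ = (Xᵀ * X + K₂)⁻¹ := by simpa using hB.inv.isHermitian.eq
  have hAt : (Xᵀ * Ω⁻¹ * X + K₁)ᵀ = Xᵀ * Ω⁻¹ * X + K₁ := by simpa using hA.isHermitian.eq
  have hAu : IsUnit (Xᵀ * Ω⁻¹ * X + K₁).det := (Matrix.isUnit_iff_isUnit_det _).mp hA.isUnit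
  have hBu : IsUnit (Xᵀ * X + K₂).det := (Matrix.isUnit_iff_isUnit_det _).mp hB.isUnit
  generalize hAd : Xᵀ * Ω⁻¹ * X + K₁ = A at *
  generalize hBd : Xᵀ * X + K₂ = B at *
  constructor
  · intro h
    have h1 : Xᵀ * Ω⁻¹ = A * (B⁻¹ * Xᵀ) := by
      rw [← h, Matrix.mul_nonsing_inv_cancel_left _ _ hAu]
    have h2 : Ω⁻¹ * X = X * (B⁻¹ * A) := by
      have := congrArg Matrix.transpose h1
      simpa only [Matrix.transpose_mul, Matrix.transpose_transpose, hΩt, hBt, hAt,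
        Matrix.mul_assoc] using this
    refine ⟨B⁻¹ * A, ?_, ?_⟩
    · rw [Matrix.mul_assoc, ← h2, Matrix.mul_nonsing_inv_cancel_left _ _ hΩu]
    · have h3 : B * (B⁻¹ * A) = A := Matrix.mul_nonsing_inv_cancel_left _ _ hBu
      have h4 : (Xᵀ * X + K₂) * (B⁻¹ * A) = Xᵀ * Ω⁻¹ * X + K₁ := by rw [hBd, hAd, h3]
      rw [Matrix.add_mul, Matrix.mul_assoc Xᵀ X, ← h2, Matrix.mul_assoc Xᵀ] at h4
      exact (add_left_cancel h4).symm
  · rintro ⟨G, hG, hK⟩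
    have h2 : Ω⁻¹ * X = X * G := by
      conv_lhs => rw [hG]
      rw [Matrix.mul_assoc, Matrix.nonsing_inv_mul_cancel_left _ _ hΩu]
    have h3 : A = B * G := by
      rw [← hBd, ← hAd, Matrix.add_mul, Matrix.mul_assoc, Matrix.mul_assoc, h2, hK]
    have h4 : G = B⁻¹ * A := by
      rw [h3, Matrix.nonsing_inv_mul_cancel_left _ _ hBu]
    have h1 : Xᵀ * Ω⁻¹ = A * (B⁻¹ * Xᵀ) := by
      have := congrArg Matrix.transpose h2
      rw [h4] at this
      simpa only [Matrix.transpose_mul, Matrix.transpose_transpose, hΩt, hBt, hAt,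
        Matrix.mul_assoc] using this
    rw [h1, Matrix.nonsing_inv_mul_cancel_left _ _ hAu]
end

section
/- Let K₁ and K₂ be real k×k symmetric positive definite matrices. Then β̂(Ω,K₁)y = β̂(I_n,K₂)y for every y ∈ ℝⁿ if and only if X = ΩXK₂⁻¹K₁. -/
open Matrix

theorem stmt_6 (n k : ℕ) (hk : 0 < k) (hn : k < n)
    (X : Matrix (Fin n) (Fin k) ℝ) (hX : X.rank = k)
    (Z : Matrix (Fin n) (Fin (n - k)) ℝ) (hXZ : Xᵀ * Z = 0) (hZ : Z.rank = n - k)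
    (Ω : Matrix (Fin n) (Fin n) ℝ) (hΩ : Ω.PosDef)
    (K₁ K₂ : Matrix (Fin k) (Fin k) ℝ) (hK₁ : K₁.PosDef) (hK₂ : K₂.PosDef) :
    (∀ y : Fin n → ℝ, ridge X Ω K₁ y = ridge X 1 K₂ y) ↔ X = Ω * X * K₂⁻¹ * K₁ := by
  have uΩ : IsUnit Ω.det := (Matrix.isUnit_iff_isUnit_det _).1 hΩ.isUnit
  have u1 : IsUnit K₁.det := (Matrix.isUnit_iff_isUnit_det _).1 hK₁.isUnit
  have u2 : IsUnit K₂.det := (Matrix.isUnit_iff_isUnit_det _).1 hK₂.isUnit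
  have tΩ : Ωᵀ = Ω := by simpa [Matrix.IsHermitian] using hΩ.isHermitian
  have t1 : K₁ᵀ = K₁ := by simpa [Matrix.IsHermitian] using hK₁.isHermitian
  have t2 : K₂ᵀ = K₂ := by simpa [Matrix.IsHermitian] using hK₂.isHermitian
  have pA : (Xᵀ * Ω⁻¹ * X + K₁).PosDef := by
    refine Matrix.PosDef.posSemidef_add ?_ hK₁
    simpa using hΩ.inv.posSemidef.conjTranspose_mul_mul_same X
  have pB : (Xᵀ * X + K₂).PosDef := by
    refine Matrix.PosDef.posSemidef_add ?_ hK₂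
    simpa using Matrix.posSemidef_conjTranspose_mul_self X
  have uA := (Matrix.isUnit_iff_isUnit_det _).1 pA.isUnit
  have uB := (Matrix.isUnit_iff_isUnit_det _).1 pB.isUnit
  have e1 : (∀ y : Fin n → ℝ, ridge X Ω K₁ y = ridge X 1 K₂ y) ↔
      (Xᵀ * Ω⁻¹ * X + K₁)⁻¹ * (Xᵀ * Ω⁻¹) = (Xᵀ * X + K₂)⁻¹ * Xᵀ := by
    simp only [ridge, inv_one, Matrix.mul_one, Matrix.mul_assoc]
    constructor
    · intro h
      exact Matrix.mulVec_injective (funext h)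
    · intro h y
      rw [h]
  have e2 : X = Ω * X * K₂⁻¹ * K₁ ↔ Xᵀ * Ω⁻¹ = K₁ * K₂⁻¹ * Xᵀ := by
    constructor
    · intro h
      have h2 : Xᵀ = K₁ * K₂⁻¹ * Xᵀ * Ω := by
        have := congrArg Matrix.transpose h
        simpa [Matrix.transpose_mul, Matrix.transpose_nonsing_inv, tΩ, t1, t2,
          Matrix.mul_assoc] using this
      calc Xᵀ * Ω⁻¹ = K₁ * K₂⁻¹ * Xᵀ * Ω * Ω⁻¹ := by rw [← h2]
        _ = _ := Matrix.mul_nonsing_inv_cancel_right _ _ uΩ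
    · intro h
      have h2 : Ω⁻¹ * X = X * (K₂⁻¹ * K₁) := by
        have := congrArg Matrix.transpose h
        simpa [Matrix.transpose_mul, Matrix.transpose_nonsing_inv, tΩ, t1, t2,
          Matrix.mul_assoc] using this
      rw [Matrix.mul_assoc, Matrix.mul_assoc, ← h2, Matrix.mul_nonsing_inv_cancel_left _ _ uΩ]
  rw [e1, e2]
  constructor
  · intro h
    have h1 : Xᵀ * Ω⁻¹ = (Xᵀ * Ω⁻¹ * X + K₁) * (Xᵀ * X + K₂)⁻¹ * Xᵀ := by
      rw [Matrix.mul_assoc _ _ Xᵀ, ← h, Matrix.mul_nonsing_inv_cancel_left _ _ uA]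
    generalize hM : (Xᵀ * Ω⁻¹ * X + K₁) * (Xᵀ * X + K₂)⁻¹ = M at h1
    have h2 : Xᵀ * Ω⁻¹ * X + K₁ = M * (Xᵀ * X + K₂) := by
      rw [← hM, Matrix.nonsing_inv_mul_cancel_right _ _ uB]
    rw [h1, Matrix.mul_add, Matrix.mul_assoc] at h2
    have h3 := add_left_cancel h2
    rw [h3, Matrix.mul_nonsing_inv_cancel_right _ _ u2, h1]
  · intro h
    have hA : Xᵀ * Ω⁻¹ * X + K₁ = K₁ * K₂⁻¹ * (Xᵀ * X + K₂) := by
      rw [h, Matrix.mul_add, Matrix.nonsing_inv_mul_cancel_right _ _ u2, Matrix.mul_assoc _ Xᵀ X]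
    have h4 : (Xᵀ * Ω⁻¹ * X + K₁) * ((Xᵀ * X + K₂)⁻¹ * Xᵀ) = Xᵀ * Ω⁻¹ := by
      rw [hA, Matrix.mul_assoc, Matrix.mul_nonsing_inv_cancel_left _ _ uB, h]
    generalize Xᵀ * Ω⁻¹ * X + K₁ = A at *
    rw [← h4, Matrix.nonsing_inv_mul_cancel_left _ _ uA]
end

section
/- Let K be a real k×k symmetric positive definite matrix. Then β̂(Ω,K)y = β̂(I_n,K)y for every y ∈ ℝⁿ if and only if X = ΩX. -/
open Matrix

theorem stmt_7 (n k : ℕ) (hk : 0 < k) (hn : k < n)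
    (X : Matrix (Fin n) (Fin k) ℝ) (hX : X.rank = k)
    (Z : Matrix (Fin n) (Fin (n - k)) ℝ) (hXZ : Xᵀ * Z = 0) (hZ : Z.rank = n - k)
    (Ω : Matrix (Fin n) (Fin n) ℝ) (hΩ : Ω.PosDef)
    (K : Matrix (Fin k) (Fin k) ℝ) (hK : K.PosDef) :
    (∀ y : Fin n → ℝ, ridge X Ω K y = ridge X 1 K y) ↔ X = Ω * X := by
  have hΩu : IsUnit Ω.det := (Matrix.isUnit_iff_isUnit_det _).1 hΩ.isUnit
  have hKu : IsUnit K.det := (Matrix.isUnit_iff_isUnit_det _).1 hK.isUnit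
  have hΩt : Ωᵀ = Ω := by simpa [Matrix.conjTranspose_eq_transpose_of_trivial] using hΩ.isHermitian.eq
  constructor
  · intro h
    have hA : (Xᵀ * Ω⁻¹ * X).PosSemidef := by
      simpa [Matrix.conjTranspose_eq_transpose_of_trivial] using
        hΩ.inv.posSemidef.conjTranspose_mul_mul_same X
    have hB : (Xᵀ * X).PosSemidef := by
      simpa [Matrix.conjTranspose_eq_transpose_of_trivial] using
        Matrix.posSemidef_conjTranspose_mul_self X
    have hPu := (Matrix.isUnit_iff_isUnit_det _).1 (hK.posSemidef_add hA).isUnit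
    have hQu := (Matrix.isUnit_iff_isUnit_det _).1 (hK.posSemidef_add hB).isUnit
    have h1 : (Xᵀ * Ω⁻¹ * X + K)⁻¹ * Xᵀ * Ω⁻¹ = (Xᵀ * X + K)⁻¹ * Xᵀ := by
      apply Matrix.mulVec_injective
      funext y
      simpa [ridge] using h y
    generalize hP : Xᵀ * Ω⁻¹ * X + K = P at *
    generalize hQ : Xᵀ * X + K = Q at *
    have h2 : P⁻¹ * (P - K) = Q⁻¹ * (Q - K) := by
      have := congrArg (· * X) h1
      rw [← hP, ← hQ, add_sub_cancel_right, add_sub_cancel_right, hP, hQ]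
      simpa only [Matrix.mul_assoc] using this
    rw [Matrix.mul_sub, Matrix.mul_sub, Matrix.nonsing_inv_mul _ hPu,
      Matrix.nonsing_inv_mul _ hQu, sub_right_inj] at h2
    have h3 : P⁻¹ = Q⁻¹ := by
      have := congrArg (· * K⁻¹) h2
      simpa [Matrix.mul_assoc, Matrix.mul_nonsing_inv _ hKu] using this
    rw [h3] at h1
    have h4 : Xᵀ * Ω⁻¹ = Xᵀ := by
      have := congrArg (Q * ·) h1
      simpa [← Matrix.mul_assoc, Matrix.mul_nonsing_inv _ hQu] using this
    have h5 : Xᵀ = Xᵀ * Ω := by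
      conv_rhs => rw [← h4]
      rw [Matrix.mul_assoc, Matrix.nonsing_inv_mul _ hΩu, Matrix.mul_one]
    have := congrArg Matrix.transpose h5
    simpa [Matrix.transpose_mul, hΩt] using this
  · intro h y
    have h5 : Xᵀ = Xᵀ * Ω := by
      have := congrArg Matrix.transpose h
      rwa [Matrix.transpose_mul, hΩt] at this
    have h4 : Xᵀ * Ω⁻¹ = Xᵀ := by
      conv_lhs => rw [h5]
      rw [Matrix.mul_assoc, Matrix.mul_nonsing_inv _ hΩu, Matrix.mul_one]
    simp only [ridge, inv_one, Matrix.mul_one]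
    rw [h4, Matrix.mul_assoc, h4]
end

section
/- Let K₁ and K₂ be real k×k symmetric positive semidefinite idempotent matrices (K₁² = K₁ and K₂² = K₂). If β̂(Ω,K₁)y = β̂(I_n,K₂)y for every y ∈ ℝⁿ, then β̂(Ω,0)y = β̂(I_n,0)y for every y ∈ ℝⁿ and K₁ = K₂. -/
open Matrix

theorem stmt_8 (n k : ℕ) (hk : 0 < k) (hn : k < n)
    (X : Matrix (Fin n) (Fin k) ℝ) (hX : X.rank = k)
    (Z : Matrix (Fin n) (Fin (n - k)) ℝ) (hXZ : Xᵀ * Z = 0) (hZ : Z.rank = n - k)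
    (Ω : Matrix (Fin n) (Fin n) ℝ) (hΩ : Ω.PosDef)
    (K₁ K₂ : Matrix (Fin k) (Fin k) ℝ) (hK₁ : K₁.PosSemidef) (hK₂ : K₂.PosSemidef)
    (hK₁i : K₁ * K₁ = K₁) (hK₂i : K₂ * K₂ = K₂)
    (h : ∀ y : Fin n → ℝ, ridge X Ω K₁ y = ridge X 1 K₂ y) :
    (∀ y : Fin n → ℝ, ridge X Ω 0 y = ridge X 1 0 y) ∧ K₁ = K₂ := by
  have hinj : Function.Injective X.mulVec := by
    rw [Matrix.mulVec_injective_iff]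
    rw [linearIndependent_iff_card_eq_finrank_span, Fintype.card_fin]
    rw [Matrix.rank_eq_finrank_span_cols] at hX
    exact hX.symm
  have hA : (Xᵀ * Ω⁻¹ * X).PosDef := by
    have := hΩ.inv.conjTranspose_mul_mul_same (B := X) hinj
    rwa [conjTranspose_eq_transpose_of_trivial] at this
  have hB : (Xᵀ * X).PosDef := by
    have := (Matrix.PosDef.one (n := Fin n) (R := ℝ)).conjTranspose_mul_mul_same (B := X) hinj
    rwa [conjTranspose_eq_transpose_of_trivial, Matrix.mul_one] at this
  have h0 : (Xᵀ * Ω⁻¹ * X + K₁)⁻¹ * Xᵀ * Ω⁻¹ = (Xᵀ * X + K₂)⁻¹ * Xᵀ := by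
    apply Matrix.mulVec_injective
    funext y
    simpa [ridge] using h y
  have hP := (Matrix.isUnit_iff_isUnit_det _).1 (hA.add_posSemidef hK₁).isUnit
  have hQ := (Matrix.isUnit_iff_isUnit_det _).1 (hB.add_posSemidef hK₂).isUnit
  have hBu := (Matrix.isUnit_iff_isUnit_det _).1 hB.isUnit
  generalize hAe : Xᵀ * Ω⁻¹ * X = A at *
  generalize hBe : Xᵀ * X = B at *
  obtain ⟨M, hM⟩ : ∃ M, M = (A + K₁) * (B + K₂)⁻¹ := ⟨_, rfl⟩
  obtain ⟨N, hN⟩ : ∃ N, N = (B + K₂) * (A + K₁)⁻¹ := ⟨_, rfl⟩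
  have hNM : N * M = 1 := by
    rw [hN, hM, Matrix.mul_assoc, Matrix.nonsing_inv_mul_cancel_left _ _ hP,
      Matrix.mul_nonsing_inv _ hQ]
  have h1 : Xᵀ * Ω⁻¹ = M * Xᵀ := by
    rw [hM, Matrix.mul_assoc, ← h0, Matrix.mul_assoc _ Xᵀ,
      Matrix.mul_nonsing_inv_cancel_left _ _ hP]
  have h2 : A = M * B := by rw [← hAe, h1, ← hBe, Matrix.mul_assoc]
  have h3 : A + K₁ = M * (B + K₂) := by
    rw [hM, Matrix.mul_assoc, Matrix.nonsing_inv_mul _ hQ, Matrix.mul_one]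
  have h4 : K₁ = M * K₂ := by
    rw [Matrix.mul_add, ← h2] at h3
    exact add_left_cancel h3
  have h5 : K₂ = N * K₁ := by rw [h4, ← Matrix.mul_assoc, hNM, Matrix.one_mul]
  have h6 : K₁ * K₂ = K₁ := by
    conv_lhs => rw [h4, Matrix.mul_assoc, hK₂i]
    exact h4.symm
  have h7 : K₂ * K₁ = K₂ := by
    conv_lhs => rw [h5, Matrix.mul_assoc, hK₁i]
    exact h5.symm
  constructor
  · intro y
    have : A⁻¹ * Xᵀ * Ω⁻¹ = B⁻¹ * Xᵀ := by
      rw [Matrix.mul_assoc, h1, h2, Matrix.mul_inv_rev, Matrix.inv_eq_left_inv hNM,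
        Matrix.mul_assoc, ← Matrix.mul_assoc N, hNM, Matrix.one_mul]
    simp only [ridge, add_zero, inv_one, Matrix.mul_one]
    rw [hAe, hBe, this]
  · have h8 := congrArg conjTranspose h6
    rw [conjTranspose_mul, hK₁.1.eq, hK₂.1.eq, h7] at h8
    exact h8.symm
end

section
/- Let K₁ and K₂ be real k×k symmetric positive semidefinite matrices and set A = XᵀΩ⁻¹X (which is positive definite, hence invertible). Then (A + K₁)⁻¹Aβ = (XᵀX + K₂)⁻¹XᵀXβ for every β ∈ ℝᵏ (i.e., the two general ridge estimators β̂(Ω,K₁) and β̂(I_n,K₂) have equal expectations under the model E[y] = Xβ for every β) if and only if XᵀX A⁻¹K₁ = K₂. -/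
open Matrix

theorem aux_inj {n k : ℕ} (X : Matrix (Fin n) (Fin k) ℝ) (hX : X.rank = k) :
    Function.Injective X.mulVec := by
  have h : LinearIndependent ℝ X.col := by
    rw [linearIndependent_iff_card_eq_finrank_span, Fintype.card_fin, Set.finrank,
      ← Matrix.rank_eq_finrank_span_cols, hX]
  exact Matrix.mulVec_injective_iff.2 h

theorem aux_alg {k : ℕ} (A G M N : Matrix (Fin k) (Fin k) ℝ) (hA : IsUnit A.det)
    (hG : IsUnit G.det) (hM : IsUnit M.det) (hN : IsUnit N.det) :
    M⁻¹ * A = N⁻¹ * G ↔ G * A⁻¹ * M = N := by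
  constructor
  · intro h
    have h1 : G = N * (M⁻¹ * A) := by rw [h, Matrix.mul_nonsing_inv_cancel_left _ _ hN]
    rw [h1, ← Matrix.mul_assoc, Matrix.mul_nonsing_inv_cancel_right _ _ hA,
      Matrix.nonsing_inv_mul_cancel_right _ _ hM]
  · intro h
    rw [← h, Matrix.mul_inv_rev, Matrix.mul_inv_rev, Matrix.nonsing_inv_nonsing_inv _ hA,
      Matrix.mul_assoc, Matrix.nonsing_inv_mul_cancel_right _ _ hG]

theorem stmt_9 (n k : ℕ) (hk : 0 < k) (hn : k < n)
    (X : Matrix (Fin n) (Fin k) ℝ) (hX : X.rank = k)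
    (Z : Matrix (Fin n) (Fin (n - k)) ℝ) (hXZ : Xᵀ * Z = 0) (hZ : Z.rank = n - k)
    (Ω : Matrix (Fin n) (Fin n) ℝ) (hΩ : Ω.PosDef)
    (K₁ K₂ : Matrix (Fin k) (Fin k) ℝ) (hK₁ : K₁.PosSemidef) (hK₂ : K₂.PosSemidef)
    (A : Matrix (Fin k) (Fin k) ℝ) (hA : A = Xᵀ * Ω⁻¹ * X) :
    (∀ β : Fin k → ℝ,
        ((A + K₁)⁻¹ * A).mulVec β = ((Xᵀ * X + K₂)⁻¹ * (Xᵀ * X)).mulVec β) ↔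
      Xᵀ * X * A⁻¹ * K₁ = K₂ := by
  have hinj := aux_inj X hX
  have pA : A.PosDef := by
    have := hΩ.inv.conjTranspose_mul_mul_same hinj
    rwa [Matrix.conjTranspose_eq_transpose_of_trivial, ← hA] at this
  have pG : (Xᵀ * X).PosDef := by
    have := (Matrix.PosDef.one (n := Fin n) (R := ℝ)).conjTranspose_mul_mul_same hinj
    rwa [Matrix.conjTranspose_eq_transpose_of_trivial, Matrix.mul_one] at this
  have u : ∀ B : Matrix (Fin k) (Fin k) ℝ, B.PosDef → IsUnit B.det :=
    fun B hB => (Matrix.isUnit_iff_isUnit_det B).1 hB.isUnit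
  have e : (∀ β : Fin k → ℝ,
        ((A + K₁)⁻¹ * A).mulVec β = ((Xᵀ * X + K₂)⁻¹ * (Xᵀ * X)).mulVec β) ↔
        (A + K₁)⁻¹ * A = (Xᵀ * X + K₂)⁻¹ * (Xᵀ * X) :=
    ⟨fun h => Matrix.mulVec_injective (funext h), fun h β => by rw [h]⟩
  rw [e, aux_alg _ _ _ _ (u _ pA) (u _ pG) (u _ (pA.add_posSemidef hK₁))
    (u _ (pG.add_posSemidef hK₂)), Matrix.mul_add,
    Matrix.nonsing_inv_mul_cancel_right _ _ (u _ pA), add_right_inj]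
end

section
/- Let K₁ and K₂ be real k×k symmetric positive semidefinite matrices, set A = XᵀΩ⁻¹X, and define Γ = (XᵀX)⁻¹XᵀΩX(XᵀX)⁻¹, Ξ = (XᵀX)⁻¹XᵀΩZ(ZᵀZ)⁻¹ and Δ = (ZᵀZ)⁻¹ZᵀΩZ(ZᵀZ)⁻¹. Then the two identities (A + K₁)⁻¹A = (XᵀX + K₂)⁻¹XᵀX (equality of the expectations of β̂(Ω,K₁) and β̂(I_n,K₂) for every β) and (A + K₁)⁻¹A(A + K₁)⁻¹ = (XᵀX + K₂)⁻¹XᵀΩX(XᵀX + K₂)⁻¹ (equality of the covariance matrices of β̂(Ω,K₁) and β̂(I_n,K₂)) both hold if and only if both of the following hold: XᵀX A⁻¹K₁ = K₂, and A + K₁ΞΔ⁻¹ΞᵀK₁ = (I_k − K₁ΞΔ⁻¹Ξᵀ)Γ⁻¹(I_k − ΞΔ⁻¹ΞᵀK₁). -/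
open Matrix

theorem aux_one {R : Type*} [Ring R] {S A Ai K₁ K₂ B C : R}
    (hAi : A * Ai = 1) (hAi' : Ai * A = 1) (hB : (A + K₁) * B = 1) (hB' : B * (A + K₁) = 1)
    (hC : (S + K₂) * C = 1) (hC' : C * (S + K₂) = 1) :
    B * A = C * S ↔ S * Ai * K₁ = K₂ := by
  have e : S * Ai * (A + K₁) = S + S * Ai * K₁ := by
    rw [mul_add, mul_assoc S Ai A, hAi', mul_one]
  constructor
  · intro h
    have h1 : S = (S + K₂) * (B * A) := by rw [h, ← mul_assoc, hC, one_mul]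
    have h2 : S * Ai * (A + K₁) = S + K₂ := by
      calc S * Ai * (A + K₁) = ((S + K₂) * (B * A)) * Ai * (A + K₁) := by rw [← h1]
        _ = (S + K₂) * (B * (A * Ai) * (A + K₁)) := by noncomm_ring
        _ = S + K₂ := by rw [hAi, mul_one, hB', mul_one]
    rw [e] at h2
    exact add_left_cancel h2
  · intro h
    rw [h] at e
    calc B * A = (C * (S + K₂)) * (B * A) := by rw [hC', one_mul]
      _ = C * S * Ai * ((A + K₁) * B) * A := by rw [← e]; noncomm_ring
      _ = C * S := by rw [hB, mul_one, mul_assoc, hAi', mul_one]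

theorem aux_two {R : Type*} [Ring R] {S A Ai G P K₁ B C : R}
    (hAi : A * Ai = 1) (hAi' : Ai * A = 1) (hB : (A + K₁) * B = 1) (hB' : B * (A + K₁) = 1)
    (hP : G = Ai + P) (h1 : B * A = C * S) (h2 : A * B = S * C) :
    B * A * B = C * (S * G * S) * C ↔ P = 0 := by
  have e : C * (S * G * S) * C = B * A * B + B * A * P * A * B := by
    calc C * (S * G * S) * C = (C * S) * G * (S * C) := by noncomm_ring
      _ = B * (A * Ai) * A * B + B * A * P * A * B := by rw [← h1, ← h2, hP]; noncomm_ring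
      _ = _ := by rw [hAi, mul_one]
  rw [e]
  constructor
  · intro h
    have h3 : B * A * P * A * B = 0 := by simpa using h
    calc P = (Ai * ((A + K₁) * B) * A) * P * (A * (B * (A + K₁)) * Ai) := by
            rw [hB, hB', mul_one, mul_one, hAi, hAi', mul_one, one_mul]
      _ = Ai * (A + K₁) * (B * A * P * A * B) * (A + K₁) * Ai := by noncomm_ring
      _ = 0 := by rw [h3]; simp
  · rintro rfl
    simp

theorem aux_three {R : Type*} [Ring R] {A Ai G Gi P K₁ B : R}
    (hAi : A * Ai = 1) (hAi' : Ai * A = 1) (hB : (A + K₁) * B = 1) (hB' : B * (A + K₁) = 1)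
    (hG : G * Gi = 1) (hG' : Gi * G = 1)
    (hP : G = Ai + P) :
    A + K₁ * P * K₁ = (1 - K₁ * P) * Gi * (1 - P * K₁) ↔ P = 0 := by
  have hP' : P = G - Ai := by rw [hP]; abel
  have m1 : (P * Gi * Ai) * A = P * Gi := by rw [mul_assoc, hAi', mul_one]
  have m2 : A * (P * Gi) = A - Gi := by
    rw [hP', sub_mul, hG, mul_sub, ← mul_assoc, hAi]; simp
  have m3 : A * (P * Gi * Ai) = Gi * P := by
    rw [← mul_assoc, m2, sub_mul, hAi, hP', mul_sub, hG']
  have m4 : P * Gi * Ai = P - P * Gi * P := by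
    have : Ai = G - P := by rw [hP]; abel
    rw [this, mul_sub, mul_assoc, hG', mul_one]
  have key : (A + K₁) * (P * Gi * Ai) * (A + K₁)
      = (A + K₁ * P * K₁) - (1 - K₁ * P) * Gi * (1 - P * K₁) := by
    calc (A + K₁) * (P * Gi * Ai) * (A + K₁)
        = A * ((P * Gi * Ai) * A) + K₁ * ((P * Gi * Ai) * A) + (A * (P * Gi * Ai)) * K₁
          + K₁ * (P * Gi * Ai) * K₁ := by noncomm_ring
      _ = _ := by rw [m1, m2, m3, m4]; noncomm_ring
  rw [← sub_eq_zero, ← key]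
  constructor
  · intro h
    calc P = P * (Gi * (Ai * A) * G) := by rw [hAi', mul_one, hG', mul_one]
      _ = (B * (A + K₁)) * (P * Gi * Ai) * ((A + K₁) * B) * A * G := by
          rw [hB, hB']; noncomm_ring
      _ = B * ((A + K₁) * (P * Gi * Ai) * (A + K₁)) * B * A * G := by noncomm_ring
      _ = 0 := by rw [h]; simp
  · rintro rfl
    simp

/-- The block identity `A (Γ - Ξ Δ⁻¹ Ξᵀ) = 1`, in unfolded form. -/
theorem aux_block {n k : ℕ} (hn : k < n)
    (X : Matrix (Fin n) (Fin k) ℝ) (Z : Matrix (Fin n) (Fin (n - k)) ℝ) (hXZ : Xᵀ * Z = 0)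
    (Ω Ωi : Matrix (Fin n) (Fin n) ℝ) (hΩ : Ωi * Ω = 1)
    (Si : Matrix (Fin k) (Fin k) ℝ) (hS : Si * (Xᵀ * X) = 1) (hS' : (Xᵀ * X) * Si = 1)
    (Ti : Matrix (Fin (n - k)) (Fin (n - k)) ℝ) (hT : Ti * (Zᵀ * Z) = 1)
    (V : Matrix (Fin (n - k)) (Fin (n - k)) ℝ) (hV : (Zᵀ * Ω * Z) * V = 1) :
    (Xᵀ * Ωi * X) * (Si * Xᵀ * Ω * X * Si
      - Si * Xᵀ * Ω * Z * V * (Zᵀ * Ω * X * Si)) = 1 := by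
  have hZX : Zᵀ * X = 0 := by
    have := congrArg Matrix.transpose hXZ
    simpa using this
  have hW : fromRows (Si * Xᵀ) (Ti * Zᵀ) * fromCols X Z = 1 := by
    rw [fromRows_mul_fromCols, Matrix.mul_assoc, Matrix.mul_assoc, Matrix.mul_assoc,
      Matrix.mul_assoc, hS, hT, hXZ, hZX, Matrix.mul_zero, Matrix.mul_zero, fromBlocks_one]
  have hW' : fromCols X Z * fromRows (Si * Xᵀ) (Ti * Zᵀ) = 1 := by
    refine (mul_eq_one_comm_of_card_eq _ _ _ ?_).mp hW
    simp; omega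
  rw [fromCols_mul_fromRows] at hW'
  have hZQ : Zᵀ * (Ω - Ω * Z * V * (Zᵀ * Ω)) = 0 := by
    have : Zᵀ * (Ω * Z * V * (Zᵀ * Ω)) = (Zᵀ * Ω * Z * V) * (Zᵀ * Ω) := by
      simp only [Matrix.mul_assoc]
    rw [Matrix.mul_sub, this, hV, Matrix.one_mul, sub_self]
  have hQ : X * (Si * Xᵀ) * (Ω - Ω * Z * V * (Zᵀ * Ω)) = Ω - Ω * Z * V * (Zᵀ * Ω) := by
    have h := congrArg (· * (Ω - Ω * Z * V * (Zᵀ * Ω))) hW'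
    simp only [Matrix.add_mul, Matrix.one_mul] at h
    rwa [show Z * (Ti * Zᵀ) * (Ω - Ω * Z * V * (Zᵀ * Ω))
      = Z * (Ti * (Zᵀ * (Ω - Ω * Z * V * (Zᵀ * Ω)))) by simp only [Matrix.mul_assoc],
      hZQ, Matrix.mul_zero, Matrix.mul_zero, add_zero] at h
  have e1 : Si * Xᵀ * Ω * X * Si - Si * Xᵀ * Ω * Z * V * (Zᵀ * Ω * X * Si)
      = Si * Xᵀ * (Ω - Ω * Z * V * (Zᵀ * Ω)) * (X * Si) := by
    simp only [Matrix.mul_sub, Matrix.sub_mul, Matrix.mul_assoc]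
  rw [e1]
  calc (Xᵀ * Ωi * X) * (Si * Xᵀ * (Ω - Ω * Z * V * (Zᵀ * Ω)) * (X * Si))
      = Xᵀ * Ωi * (X * (Si * Xᵀ) * (Ω - Ω * Z * V * (Zᵀ * Ω))) * (X * Si) := by
        simp only [Matrix.mul_assoc]
    _ = Xᵀ * (Ωi * Ω) * X * Si - (Xᵀ * (Ωi * Ω) * Z) * (V * (Zᵀ * Ω) * (X * Si)) := by
        rw [hQ]; simp only [Matrix.mul_sub, Matrix.sub_mul, Matrix.mul_assoc]
    _ = 1 := by
        rw [hΩ, Matrix.mul_one, hXZ, hS', Matrix.zero_mul, sub_zero]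


theorem stmt_11 (n k : ℕ) (hk : 0 < k) (hn : k < n)
    (X : Matrix (Fin n) (Fin k) ℝ) (hX : X.rank = k)
    (Z : Matrix (Fin n) (Fin (n - k)) ℝ) (hXZ : Xᵀ * Z = 0) (hZ : Z.rank = n - k)
    (Ω : Matrix (Fin n) (Fin n) ℝ) (hΩ : Ω.PosDef)
    (K₁ K₂ : Matrix (Fin k) (Fin k) ℝ) (hK₁ : K₁.PosSemidef) (hK₂ : K₂.PosSemidef)
    (A : Matrix (Fin k) (Fin k) ℝ) (hA : A = Xᵀ * Ω⁻¹ * X)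
    (Γ : Matrix (Fin k) (Fin k) ℝ) (hΓ : Γ = (Xᵀ * X)⁻¹ * Xᵀ * Ω * X * (Xᵀ * X)⁻¹)
    (Ξ : Matrix (Fin k) (Fin (n - k)) ℝ) (hΞ : Ξ = (Xᵀ * X)⁻¹ * Xᵀ * Ω * Z * (Zᵀ * Z)⁻¹)
    (Δ : Matrix (Fin (n - k)) (Fin (n - k)) ℝ)
    (hΔ : Δ = (Zᵀ * Z)⁻¹ * Zᵀ * Ω * Z * (Zᵀ * Z)⁻¹) :
    ((A + K₁)⁻¹ * A = (Xᵀ * X + K₂)⁻¹ * (Xᵀ * X) ∧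
        (A + K₁)⁻¹ * A * (A + K₁)⁻¹ =
          (Xᵀ * X + K₂)⁻¹ * (Xᵀ * Ω * X) * (Xᵀ * X + K₂)⁻¹) ↔
      (Xᵀ * X * A⁻¹ * K₁ = K₂ ∧
        A + K₁ * Ξ * Δ⁻¹ * Ξᵀ * K₁ =
          (1 - K₁ * Ξ * Δ⁻¹ * Ξᵀ) * Γ⁻¹ * (1 - Ξ * Δ⁻¹ * Ξᵀ * K₁)) := by
  have iX := aux_inj X hX
  have iZ := aux_inj Z hZ
  have pS : (Xᵀ * X).PosDef := by
    simpa using Matrix.PosDef.conjTranspose_mul_self X iX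
  have pT : (Zᵀ * Z).PosDef := by
    simpa using Matrix.PosDef.conjTranspose_mul_self Z iZ
  have pA : A.PosDef := by
    rw [hA]; simpa using hΩ.inv.conjTranspose_mul_mul_same iX
  have pH : (Xᵀ * Ω * X).PosDef := by
    simpa using hΩ.conjTranspose_mul_mul_same iX
  have pV : (Zᵀ * Ω * Z).PosDef := by
    simpa using hΩ.conjTranspose_mul_mul_same iZ
  have uS := (Matrix.isUnit_iff_isUnit_det _).mp pS.isUnit
  have uT := (Matrix.isUnit_iff_isUnit_det _).mp pT.isUnit
  have uA := (Matrix.isUnit_iff_isUnit_det _).mp pA.isUnit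
  have uV := (Matrix.isUnit_iff_isUnit_det _).mp pV.isUnit
  have uΩ := (Matrix.isUnit_iff_isUnit_det _).mp hΩ.isUnit
  have uB := (Matrix.isUnit_iff_isUnit_det _).mp (pA.add_posSemidef hK₁).isUnit
  have uC := (Matrix.isUnit_iff_isUnit_det _).mp (pS.add_posSemidef hK₂).isUnit
  have sΩ : Ωᵀ = Ω := by simpa using hΩ.isHermitian.eq
  have sA : Aᵀ = A := by simpa using pA.isHermitian.eq
  have sK₁ : K₁ᵀ = K₁ := by simpa using hK₁.isHermitian.eq
  have sK₂ : K₂ᵀ = K₂ := by simpa using hK₂.isHermitian.eq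
  have sS : (Xᵀ * X)ᵀ = Xᵀ * X := by simp
  have sT : (Zᵀ * Z)ᵀ = Zᵀ * Z := by simp
  have uG : IsUnit Γ.det := by
    rw [← Matrix.isUnit_iff_isUnit_det, hΓ]
    have := (pS.inv.isUnit.mul pH.isUnit).mul pS.inv.isUnit
    simpa only [Matrix.mul_assoc] using this
  have hΔi : Δ⁻¹ = (Zᵀ * Z) * (Zᵀ * Ω * Z)⁻¹ * (Zᵀ * Z) := by
    rw [hΔ, show (Zᵀ * Z)⁻¹ * Zᵀ * Ω * Z * (Zᵀ * Z)⁻¹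
      = (Zᵀ * Z)⁻¹ * (Zᵀ * Ω * Z) * (Zᵀ * Z)⁻¹ by simp only [Matrix.mul_assoc],
      Matrix.mul_inv_rev, Matrix.mul_inv_rev, Matrix.nonsing_inv_nonsing_inv _ uT,
      ← Matrix.mul_assoc]
  have hΞt : Ξᵀ = (Zᵀ * Z)⁻¹ * (Zᵀ * Ω * X * (Xᵀ * X)⁻¹) := by
    rw [hΞ]
    simp only [Matrix.transpose_mul, Matrix.transpose_nonsing_inv, sΩ,
      Matrix.transpose_transpose, Matrix.mul_assoc]
  have hP : Ξ * Δ⁻¹ * Ξᵀ = (Xᵀ * X)⁻¹ * Xᵀ * Ω * Z * (Zᵀ * Ω * Z)⁻¹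
      * (Zᵀ * Ω * X * (Xᵀ * X)⁻¹) := by
    rw [hΔi, hΞt, hΞ]
    generalize hT' : Zᵀ * Z = T at *
    calc _ = (Xᵀ * X)⁻¹ * Xᵀ * Ω * Z * (T⁻¹ * T) * (Zᵀ * Ω * Z)⁻¹ * (T * T⁻¹)
      * (Zᵀ * Ω * X * (Xᵀ * X)⁻¹) := by simp only [Matrix.mul_assoc]
      _ = _ := by
        rw [Matrix.nonsing_inv_mul _ uT, Matrix.mul_nonsing_inv _ uT, Matrix.mul_one,
          Matrix.mul_one]
  have hblock : A * (Γ - Ξ * Δ⁻¹ * Ξᵀ) = 1 := by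
    rw [hP, hΓ, hA]
    exact aux_block hn X Z hXZ Ω Ω⁻¹ (Matrix.nonsing_inv_mul _ uΩ) _
      (Matrix.nonsing_inv_mul _ uS) (Matrix.mul_nonsing_inv _ uS) _
      (Matrix.nonsing_inv_mul _ uT) _ (Matrix.mul_nonsing_inv _ uV)
  have hGP : Γ = A⁻¹ + Ξ * Δ⁻¹ * Ξᵀ := by
    rw [Matrix.inv_eq_right_inv hblock]; abel
  have hH : Xᵀ * Ω * X = (Xᵀ * X) * Γ * (Xᵀ * X) := by
    rw [hΓ]
    generalize hS' : Xᵀ * X = S at *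
    calc _ = (S * S⁻¹) * (Xᵀ * Ω * X) * (S⁻¹ * S) := by
          rw [Matrix.nonsing_inv_mul _ uS, Matrix.mul_nonsing_inv _ uS, Matrix.mul_one,
            Matrix.one_mul]
      _ = _ := by simp only [Matrix.mul_assoc]
  have a1 := Matrix.mul_nonsing_inv _ uA
  have a2 := Matrix.nonsing_inv_mul _ uA
  have b1 := Matrix.mul_nonsing_inv _ uB
  have b2 := Matrix.nonsing_inv_mul _ uB
  have c1 := Matrix.mul_nonsing_inv _ uC
  have c2 := Matrix.nonsing_inv_mul _ uC
  have g1 := Matrix.mul_nonsing_inv _ uG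
  have g2 := Matrix.nonsing_inv_mul _ uG
  have r1 : K₁ * Ξ * Δ⁻¹ * Ξᵀ = K₁ * (Ξ * Δ⁻¹ * Ξᵀ) := by simp only [Matrix.mul_assoc]
  rw [hH, r1, aux_three a1 a2 b1 b2 g1 g2 hGP, ← aux_one a1 a2 b1 b2 c1 c2]
  refine and_congr_right fun h => ?_
  refine aux_two a1 a2 b1 b2 hGP h ?_
  have := congrArg Matrix.transpose h
  simpa only [Matrix.transpose_mul, Matrix.transpose_nonsing_inv, Matrix.transpose_add,
    Matrix.transpose_transpose, sA, sK₁, sK₂] using this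
end

section
/- Let K₁ and K₂ be real k×k symmetric positive semidefinite matrices, set A = XᵀΩ⁻¹X, and define Ξ = (XᵀX)⁻¹XᵀΩZ(ZᵀZ)⁻¹ and Δ = (ZᵀZ)⁻¹ZᵀΩZ(ZᵀZ)⁻¹. Then RSS(Ω,K₁)(y) = RSS(I_n,K₂)(y) for every y ∈ ℝⁿ if and only if the following three conditions simultaneously hold: (a) K₁(A + K₁)⁻¹A(A + K₁)⁻¹K₁ = K₂(XᵀX + K₂)⁻¹XᵀX(XᵀX + K₂)⁻¹K₂; (b) K₂(XᵀX + K₂)⁻¹K₂Ξ = 0; (c) Δ = (ZᵀZ)⁻¹. -/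
open Matrix

theorem aux_gram {n k : ℕ} (X : Matrix (Fin n) (Fin k) ℝ) (hX : X.rank = k)
    (P : Matrix (Fin n) (Fin n) ℝ) (hP : P.PosDef) : (Xᵀ * P * X).PosDef := by
  have hinj : Function.Injective X.mulVec := by
    rw [Matrix.mulVec_injective_iff]
    rw [linearIndependent_iff_card_eq_finrank_span]
    have h := Matrix.rank_eq_finrank_span_cols X
    rw [hX] at h
    rw [Fintype.card_fin]
    exact h
  have := hP.conjTranspose_mul_mul_same hinj
  simpa [Matrix.conjTranspose_eq_transpose_of_trivial] using this

theorem aux_quad {m : ℕ} (S T : Matrix (Fin m) (Fin m) ℝ) (hS : Sᵀ = S) (hT : Tᵀ = T)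
    (h : ∀ a, a ⬝ᵥ S.mulVec a = a ⬝ᵥ T.mulVec a) : S = T := by
  have sw : ∀ (S : Matrix (Fin m) (Fin m) ℝ), Sᵀ = S → ∀ a b : Fin m → ℝ,
      a ⬝ᵥ S.mulVec b = b ⬝ᵥ S.mulVec a := by
    intro S hS a b
    rw [Matrix.dotProduct_mulVec, ← Matrix.mulVec_transpose, hS, dotProduct_comm]
  have h2 : ∀ a b, a ⬝ᵥ S.mulVec b = a ⬝ᵥ T.mulVec b := by
    intro a b
    have h1 := h (a + b)
    simp only [Matrix.mulVec_add, dotProduct_add, add_dotProduct] at h1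
    rw [sw S hS b a, sw T hT b a] at h1
    linarith [h a, h b]
  apply Matrix.mulVec_injective
  funext b
  exact dotProduct_eq _ _ (fun a => by rw [dotProduct_comm, h2, dotProduct_comm])

theorem aux_ker {m l : ℕ} (K P : Matrix (Fin m) (Fin m) ℝ) (hK : Kᵀ = K) (hP : P.PosDef)
    (M : Matrix (Fin m) (Fin l) ℝ) : K * P * K * M = 0 ↔ K * M = 0 := by
  constructor
  · intro h
    apply Matrix.mulVec_injective
    funext v
    by_contra hne
    have h0 : (K * M).mulVec v ≠ 0 := by simpa using hne
    have := hP.dotProduct_mulVec_pos h0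
    have e : star ((K * M).mulVec v) ⬝ᵥ P.mulVec ((K * M).mulVec v)
        = v ⬝ᵥ (Mᵀ * (K * P * K * M)).mulVec v := by
      rw [star_trivial, dotProduct_comm, Matrix.dotProduct_mulVec, ← Matrix.mulVec_transpose,
        dotProduct_comm, Matrix.transpose_mul, hK]
      simp only [Matrix.mulVec_mulVec, Matrix.mul_assoc]
    rw [e, h] at this
    simp at this
  · intro h
    rw [Matrix.mul_assoc, h, Matrix.mul_zero]

theorem aux_span {n k : ℕ} (hn : k < n)
    (X : Matrix (Fin n) (Fin k) ℝ) (hX : X.rank = k)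
    (Z : Matrix (Fin n) (Fin (n - k)) ℝ) (hXZ : Xᵀ * Z = 0) (hZ : Z.rank = n - k)
    (Ω : Matrix (Fin n) (Fin n) ℝ) (hΩ : Ω.PosDef) (y : Fin n → ℝ) :
    ∃ a c, y = X.mulVec a + (Ω * Z).mulVec c := by
  let f : ((Fin k → ℝ) × (Fin (n - k) → ℝ)) →ₗ[ℝ] (Fin n → ℝ) :=
    (Matrix.mulVecLin X).coprod (Matrix.mulVecLin (Ω * Z))
  have hA := aux_gram X hX _ hΩ.inv
  have hH := aux_gram Z hZ _ hΩ
  have hZX : Zᵀ * X = 0 := by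
    have := congrArg Matrix.transpose hXZ
    simpa using this
  have hΩu : IsUnit Ω.det := (Matrix.isUnit_iff_isUnit_det _).1 hΩ.isUnit
  have hinj : Function.Injective f := by
    rw [injective_iff_map_eq_zero]
    rintro ⟨a, c⟩ h
    have h : X.mulVec a + (Ω * Z).mulVec c = 0 := by simpa [f] using h
    have h1 := congrArg (Xᵀ * Ω⁻¹).mulVec h
    have h2 := congrArg Zᵀ.mulVec h
    have e : Xᵀ * Ω⁻¹ * (Ω * Z) = 0 := by
      rw [Matrix.mul_assoc, Matrix.nonsing_inv_mul_cancel_left _ _ hΩu, hXZ]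
    rw [Matrix.mulVec_add, Matrix.mulVec_mulVec, Matrix.mulVec_mulVec, e] at h1
    rw [Matrix.mulVec_add, Matrix.mulVec_mulVec, Matrix.mulVec_mulVec, hZX,
      ← Matrix.mul_assoc] at h2
    have ha : a = 0 := Matrix.mulVec_injective_of_isUnit hA.isUnit (by simpa using h1)
    have hc : c = 0 := Matrix.mulVec_injective_of_isUnit hH.isUnit (by simpa using h2)
    simp [ha, hc]
  have hs : Function.Surjective f := by
    rw [← LinearMap.injective_iff_surjective_of_finrank_eq_finrank]
    · exact hinj
    · simp; omega
  obtain ⟨⟨a, c⟩, h⟩ := hs y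
  exact ⟨a, c, by rw [← h]; simp [f]⟩

theorem aux_rss {n k : ℕ}
    (X : Matrix (Fin n) (Fin k) ℝ) (hX : X.rank = k)
    (Z : Matrix (Fin n) (Fin (n - k)) ℝ) (hXZ : Xᵀ * Z = 0)
    (Φ : Matrix (Fin n) (Fin n) ℝ) (hΦ : Φ.PosDef)
    (K : Matrix (Fin k) (Fin k) ℝ) (hK : K.PosSemidef)
    (A : Matrix (Fin k) (Fin k) ℝ) (hA : A = Xᵀ * Φ⁻¹ * X)
    (a : Fin k → ℝ) (c : Fin (n - k) → ℝ) :
    RSS X Φ K (X.mulVec a + (Φ * Z).mulVec c) =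
      a ⬝ᵥ (K * (A + K)⁻¹ * A * (A + K)⁻¹ * K).mulVec a
        + c ⬝ᵥ (Zᵀ * Φ * Z).mulVec c := by
  have hAp : A.PosDef := hA ▸ aux_gram X hX _ hΦ.inv
  have hC : (A + K).PosDef := hAp.add_posSemidef hK
  have hCu : IsUnit (A + K).det := (Matrix.isUnit_iff_isUnit_det _).1 hC.isUnit
  have hΦu : IsUnit Φ.det := (Matrix.isUnit_iff_isUnit_det _).1 hΦ.isUnit
  have hZX : Zᵀ * X = 0 := by
    have := congrArg Matrix.transpose hXZ
    simpa using this
  have sK : Kᵀ = K := by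
    simpa [Matrix.conjTranspose_eq_transpose_of_trivial] using hK.isHermitian.eq
  have sC : ((A + K)⁻¹)ᵀ = (A + K)⁻¹ := by
    simpa [Matrix.conjTranspose_eq_transpose_of_trivial] using hC.inv.isHermitian.eq
  have sΦ : Φᵀ = Φ := by
    simpa [Matrix.conjTranspose_eq_transpose_of_trivial] using hΦ.isHermitian.eq
  have e : Xᵀ * Φ⁻¹ * (Φ * Z) = 0 := by
    rw [Matrix.mul_assoc, Matrix.nonsing_inv_mul_cancel_left _ _ hΦu, hXZ]
  have hr : ridge X Φ K (X.mulVec a + (Φ * Z).mulVec c) = ((A + K)⁻¹ * A).mulVec a := by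
    unfold ridge
    rw [← hA, Matrix.mul_assoc, Matrix.mulVec_add, Matrix.mulVec_mulVec, Matrix.mulVec_mulVec,
      Matrix.mul_assoc _ _ X, Matrix.mul_assoc _ _ (Φ * Z), e, ← hA]
    simp
  set L := (A + K)⁻¹ * K with hL
  have hLA : (1 : Matrix (Fin k) (Fin k) ℝ) - (A + K)⁻¹ * A = L := by
    rw [hL, sub_eq_iff_eq_add, ← Matrix.mul_add, add_comm K, Matrix.nonsing_inv_mul _ hCu]
  have hres : X.mulVec a + (Φ * Z).mulVec c - X.mulVec (((A + K)⁻¹ * A).mulVec a)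
      = (X * L).mulVec a + (Φ * Z).mulVec c := by
    rw [← hLA, Matrix.mul_sub, Matrix.sub_mulVec, Matrix.mulVec_mulVec, Matrix.mul_one]
    abel
  unfold RSS
  rw [hr, hres]
  have hd : ∀ {p q r : ℕ} (M : Matrix (Fin p) (Fin q) ℝ) (N : Matrix (Fin p) (Fin r) ℝ) u v,
      M.mulVec u ⬝ᵥ N.mulVec v = u ⬝ᵥ (Mᵀ * N).mulVec v := by
    intro p q r M N u v
    rw [← Matrix.mulVec_mulVec, Matrix.dotProduct_mulVec u, ← Matrix.mulVec_transpose,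
      Matrix.transpose_transpose]
  have e1 : (X * L)ᵀ * (Φ⁻¹ * (X * L)) = K * (A + K)⁻¹ * A * (A + K)⁻¹ * K := by
    rw [Matrix.transpose_mul, hL, Matrix.transpose_mul, sK, sC]
    conv_rhs => rw [hA]
    rw [← hA]
    conv_rhs => enter [1, 1, 2]; rw [hA]
    simp only [Matrix.mul_assoc]
  have e2 : (X * L)ᵀ * (Φ⁻¹ * (Φ * Z)) = 0 := by
    rw [Matrix.transpose_mul, Matrix.mul_assoc, ← Matrix.mul_assoc Xᵀ, e, Matrix.mul_zero]
  have e3 : (Φ * Z)ᵀ * (Φ⁻¹ * (X * L)) = 0 := by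
    rw [Matrix.transpose_mul, sΦ, Matrix.mul_assoc, Matrix.mul_nonsing_inv_cancel_left _ _ hΦu,
      ← Matrix.mul_assoc, hZX, Matrix.zero_mul]
  have e4 : (Φ * Z)ᵀ * (Φ⁻¹ * (Φ * Z)) = Zᵀ * Φ * Z := by
    rw [Matrix.nonsing_inv_mul_cancel_left _ _ hΦu, Matrix.transpose_mul, sΦ]
  rw [Matrix.mulVec_add, Matrix.mulVec_mulVec, Matrix.mulVec_mulVec, dotProduct_add,
    add_dotProduct, add_dotProduct, hd, hd, hd, hd, e1, e2, e3, e4]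
  simp

theorem stmt_12 (n k : ℕ) (hk : 0 < k) (hn : k < n)
    (X : Matrix (Fin n) (Fin k) ℝ) (hX : X.rank = k)
    (Z : Matrix (Fin n) (Fin (n - k)) ℝ) (hXZ : Xᵀ * Z = 0) (hZ : Z.rank = n - k)
    (Ω : Matrix (Fin n) (Fin n) ℝ) (hΩ : Ω.PosDef)
    (K₁ K₂ : Matrix (Fin k) (Fin k) ℝ) (hK₁ : K₁.PosSemidef) (hK₂ : K₂.PosSemidef)
    (A : Matrix (Fin k) (Fin k) ℝ) (hA : A = Xᵀ * Ω⁻¹ * X)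
    (Ξ : Matrix (Fin k) (Fin (n - k)) ℝ) (hΞ : Ξ = (Xᵀ * X)⁻¹ * Xᵀ * Ω * Z * (Zᵀ * Z)⁻¹)
    (Δ : Matrix (Fin (n - k)) (Fin (n - k)) ℝ)
    (hΔ : Δ = (Zᵀ * Z)⁻¹ * Zᵀ * Ω * Z * (Zᵀ * Z)⁻¹) :
    (∀ y : Fin n → ℝ, RSS X Ω K₁ y = RSS X 1 K₂ y) ↔
      (K₁ * (A + K₁)⁻¹ * A * (A + K₁)⁻¹ * K₁ =
          K₂ * (Xᵀ * X + K₂)⁻¹ * (Xᵀ * X) * (Xᵀ * X + K₂)⁻¹ * K₂ ∧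
        K₂ * (Xᵀ * X + K₂)⁻¹ * K₂ * Ξ = 0 ∧
        Δ = (Zᵀ * Z)⁻¹) := by
  have hZX : Zᵀ * X = 0 := by
    have := congrArg Matrix.transpose hXZ
    simpa using this
  have tr : ∀ {m : ℕ} {S : Matrix (Fin m) (Fin m) ℝ}, S.IsHermitian → Sᵀ = S := by
    intro m S h
    simpa [Matrix.conjTranspose_eq_transpose_of_trivial] using h.eq
  have hAp : A.PosDef := hA ▸ aux_gram X hX _ hΩ.inv
  have hBp : (Xᵀ * X).PosDef := by
    simpa using aux_gram X hX 1 Matrix.PosDef.one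
  have hGp : (Zᵀ * Z).PosDef := by
    simpa using aux_gram Z hZ 1 Matrix.PosDef.one
  have hHp : (Zᵀ * Ω * Z).PosDef := aux_gram Z hZ Ω hΩ
  have hBu : IsUnit (Xᵀ * X).det := (Matrix.isUnit_iff_isUnit_det _).1 hBp.isUnit
  have hGu : IsUnit (Zᵀ * Z).det := (Matrix.isUnit_iff_isUnit_det _).1 hGp.isUnit
  have hHu : IsUnit (Zᵀ * Ω * Z).det := (Matrix.isUnit_iff_isUnit_det _).1 hHp.isUnit
  have hC1 : (A + K₁).PosDef := hAp.add_posSemidef hK₁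
  have hC2 : (Xᵀ * X + K₂).PosDef := hBp.add_posSemidef hK₂
  have hone : X * ((Xᵀ * X)⁻¹ * Xᵀ) + Z * ((Zᵀ * Z)⁻¹ * Zᵀ) = 1 := by
    apply Matrix.mulVec_injective
    funext y
    obtain ⟨a, c, h⟩ := aux_span hn X hX Z hXZ hZ 1 Matrix.PosDef.one y
    rw [Matrix.one_mul] at h
    have h1 : (X * ((Xᵀ * X)⁻¹ * Xᵀ) + Z * ((Zᵀ * Z)⁻¹ * Zᵀ)) * X = X := by
      rw [Matrix.add_mul, Matrix.mul_assoc, Matrix.mul_assoc, Matrix.mul_assoc, Matrix.mul_assoc,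
        hZX, Matrix.nonsing_inv_mul _ hBu]
      simp
    have h2 : (X * ((Xᵀ * X)⁻¹ * Xᵀ) + Z * ((Zᵀ * Z)⁻¹ * Zᵀ)) * Z = Z := by
      rw [Matrix.add_mul, Matrix.mul_assoc, Matrix.mul_assoc, Matrix.mul_assoc, Matrix.mul_assoc,
        hXZ, Matrix.nonsing_inv_mul _ hGu]
      simp
    rw [h, Matrix.mulVec_add, Matrix.mulVec_mulVec, Matrix.mulVec_mulVec, h1, h2, Matrix.one_mulVec]
  set B := Xᵀ * X with hB
  set G := Zᵀ * Z with hG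
  set H := Zᵀ * Ω * Z with hH
  set E := B⁻¹ * Xᵀ * Ω * Z with hE
  have hΔ' : Δ = G⁻¹ * H * G⁻¹ := by
    rw [hΔ, hH]; simp only [Matrix.mul_assoc]
  have hdec : Ω * Z = X * E + Z * (G⁻¹ * H) := by
    calc Ω * Z = (X * (B⁻¹ * Xᵀ) + Z * (G⁻¹ * Zᵀ)) * (Ω * Z) := by rw [hone, Matrix.one_mul]
      _ = _ := by rw [Matrix.add_mul, hE, hH]; simp only [Matrix.mul_assoc]
  set M₁ := K₁ * (A + K₁)⁻¹ * A * (A + K₁)⁻¹ * K₁ with hM₁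
  set M₂ := K₂ * (B + K₂)⁻¹ * B * (B + K₂)⁻¹ * K₂ with hM₂
  have sM₁ : M₁ᵀ = M₁ := by
    rw [hM₁]
    simp only [Matrix.transpose_mul, tr hK₁.isHermitian, tr hAp.isHermitian,
      tr hC1.inv.isHermitian, Matrix.mul_assoc]
  have sM₂ : M₂ᵀ = M₂ := by
    rw [hM₂]
    simp only [Matrix.transpose_mul, tr hK₂.isHermitian, tr hBp.isHermitian,
      tr hC2.inv.isHermitian, Matrix.mul_assoc]
  have sH : Hᵀ = H := tr hHp.isHermitian
  have sG' : (G⁻¹)ᵀ = G⁻¹ := tr hGp.inv.isHermitian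
  have R1 : ∀ a c, RSS X Ω K₁ (X.mulVec a + (Ω * Z).mulVec c)
      = a ⬝ᵥ M₁.mulVec a + c ⬝ᵥ H.mulVec c :=
    aux_rss X hX Z hXZ Ω hΩ K₁ hK₁ A hA
  have R2 : ∀ a c, RSS X 1 K₂ (X.mulVec a + (Ω * Z).mulVec c)
      = (a + E.mulVec c) ⬝ᵥ M₂.mulVec (a + E.mulVec c) + c ⬝ᵥ (H * G⁻¹ * H).mulVec c := by
    intro a c
    have := aux_rss X hX Z hXZ 1 Matrix.PosDef.one K₂ hK₂ B (by simp [hB]) (a + E.mulVec c)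
      ((G⁻¹ * H).mulVec c)
    rw [Matrix.one_mul, Matrix.mul_one] at this
    rw [hdec, Matrix.add_mulVec, ← add_assoc, ← Matrix.mulVec_mulVec, ← Matrix.mulVec_add,
      ← Matrix.mulVec_mulVec _ Z, this, ← hG]
    congr 1
    rw [Matrix.mulVec_mulVec, Matrix.mul_nonsing_inv_cancel_left _ _ hGu, dotProduct_comm,
      Matrix.dotProduct_mulVec, ← Matrix.mulVec_transpose, Matrix.transpose_mul, sH, sG',
      Matrix.mulVec_mulVec, dotProduct_comm]
  have key : K₂ * (B + K₂)⁻¹ * K₂ * Ξ = 0 ↔ M₂ * E = 0 := by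
    have e1 : Ξ = E * G⁻¹ := hΞ
    have hP : ((B + K₂)⁻¹ * B * (B + K₂)⁻¹).PosDef := by
      have := hBp.conjTranspose_mul_mul_same
        (Matrix.mulVec_injective_of_isUnit hC2.inv.isUnit)
      rwa [hC2.inv.isHermitian.eq] at this
    have e2 : M₂ = K₂ * ((B + K₂)⁻¹ * B * (B + K₂)⁻¹) * K₂ := by
      rw [hM₂]; simp only [Matrix.mul_assoc]
    rw [aux_ker K₂ _ (tr hK₂.isHermitian) hC2.inv, e2,
      aux_ker K₂ _ (tr hK₂.isHermitian) hP, e1]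
    constructor
    · intro h
      have := congrArg (· * G) h
      simpa [Matrix.mul_assoc, Matrix.nonsing_inv_mul _ hGu] using this
    · intro h
      rw [← Matrix.mul_assoc, h, Matrix.zero_mul]
  have key3 : Δ = G⁻¹ ↔ H = G := by
    rw [hΔ']
    constructor
    · intro h
      have := congrArg (fun T => G * T * G) h
      simpa [Matrix.mul_assoc, Matrix.nonsing_inv_mul _ hGu,
        Matrix.mul_nonsing_inv_cancel_left _ _ hGu] using this
    · intro h
      rw [h, Matrix.nonsing_inv_mul _ hGu, Matrix.one_mul]
  rw [key, key3]
  constructor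
  · intro h
    have h' : ∀ a c, a ⬝ᵥ M₁.mulVec a + c ⬝ᵥ H.mulVec c =
        (a + E.mulVec c) ⬝ᵥ M₂.mulVec (a + E.mulVec c) + c ⬝ᵥ (H * G⁻¹ * H).mulVec c := by
      intro a c
      rw [← R1, ← R2, h]
    have hM : M₁ = M₂ := by
      apply aux_quad _ _ sM₁ sM₂
      intro a
      simpa using h' a 0
    rw [hM] at h'
    have hME : M₂ * E = 0 := by
      apply Matrix.mulVec_injective
      funext c
      apply dotProduct_eq
      intro a
      have h1 := h' a c
      have h2 := h' (-a) c
      have sw : E.mulVec c ⬝ᵥ M₂.mulVec a = a ⬝ᵥ M₂.mulVec (E.mulVec c) := by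
        rw [Matrix.dotProduct_mulVec, ← Matrix.mulVec_transpose, sM₂, dotProduct_comm]
      simp only [Matrix.mulVec_add, Matrix.mulVec_neg, dotProduct_add, add_dotProduct,
        neg_dotProduct, dotProduct_neg, sw] at h1 h2
      rw [← Matrix.mulVec_mulVec, dotProduct_comm, Matrix.zero_mulVec, zero_dotProduct]
      linarith
    refine ⟨hM, hME, ?_⟩
    have hHH : H = H * G⁻¹ * H := by
      apply aux_quad _ _ sH
      · simp only [Matrix.transpose_mul, sH, sG', Matrix.mul_assoc]
      · intro c
        have := h' 0 c
        rw [zero_add, Matrix.mulVec_mulVec, hME] at this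
        simpa using this
    have h1 : 1 = H * G⁻¹ := by
      have := congrArg (· * H⁻¹) hHH
      simpa [Matrix.mul_nonsing_inv _ hHu, Matrix.mul_nonsing_inv_cancel_right _ _ hHu] using this
    have := congrArg (· * G) h1
    simpa [Matrix.mul_assoc, Matrix.nonsing_inv_mul _ hGu] using this.symm
  · rintro ⟨hM, hME, hHG⟩ y
    obtain ⟨a, c, rfl⟩ := aux_span hn X hX Z hXZ hZ Ω hΩ y
    have hEM : Eᵀ * M₂ = 0 := by
      have := congrArg Matrix.transpose hME
      simpa [Matrix.transpose_mul, sM₂] using this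
    have hsw : E.mulVec c ⬝ᵥ M₂.mulVec a = 0 := by
      rw [Matrix.dotProduct_mulVec, ← Matrix.mulVec_transpose, sM₂, Matrix.mulVec_mulVec, hME]
      simp
    rw [R1, R2, hM, hHG, Matrix.mul_nonsing_inv _ hGu, Matrix.one_mul, Matrix.mulVec_add,
      Matrix.mulVec_mulVec, hME, Matrix.zero_mulVec, add_zero, add_dotProduct, hsw, add_zero]
end

section
/- Let K₁ and K₂ be real k×k symmetric positive definite matrices. If RSS(Ω,K₁)(y) = RSS(I_n,K₂)(y) for every y ∈ ℝⁿ, then β̂(Ω,0)y = β̂(I_n,0)y and RSS(Ω,0)(y) = RSS(I_n,0)(y) for every y ∈ ℝⁿ. -/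
open Matrix

theorem aux_symm_zero {n : ℕ} (D : Matrix (Fin n) (Fin n) ℝ) (hD : Dᵀ = D)
    (h : ∀ y : Fin n → ℝ, y ⬝ᵥ D *ᵥ y = 0) : D = 0 := by
  have hs : ∀ x y : Fin n → ℝ, x ⬝ᵥ D *ᵥ y = y ⬝ᵥ D *ᵥ x := by
    intro x y
    rw [dotProduct_mulVec, ← mulVec_transpose, hD, dotProduct_comm]
  have h2 : ∀ x y : Fin n → ℝ, x ⬝ᵥ D *ᵥ y = 0 := by
    intro x y
    have h1 := h (x + y)
    rw [mulVec_add, dotProduct_add, add_dotProduct, add_dotProduct, h x, h y, hs y x] at h1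
    linarith
  ext i j
  have := h2 (Pi.single i 1) (Pi.single j 1)
  simpa using this

theorem aux_posDef {n k : ℕ} (X : Matrix (Fin n) (Fin k) ℝ) (hX : X.rank = k)
    (W : Matrix (Fin n) (Fin n) ℝ) (hW : W.PosDef) : (Xᵀ * W * X).PosDef := by
  have := hW.conjTranspose_mul_mul_same (aux_inj X hX)
  simpa [conjTranspose_eq_transpose_of_trivial] using this

/-- residual-maker -/
noncomputable def auxE {n k : ℕ} (X : Matrix (Fin n) (Fin k) ℝ)
    (W : Matrix (Fin n) (Fin n) ℝ) (K : Matrix (Fin k) (Fin k) ℝ) : Matrix (Fin n) (Fin n) ℝ :=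
  1 - X * ((Xᵀ * W * X + K)⁻¹ * Xᵀ * W)

theorem aux_resid {n k : ℕ} (X : Matrix (Fin n) (Fin k) ℝ)
    (Φ : Matrix (Fin n) (Fin n) ℝ) (K : Matrix (Fin k) (Fin k) ℝ) (y : Fin n → ℝ) :
    y - X.mulVec (ridge X Φ K y) = auxE X Φ⁻¹ K *ᵥ y := by
  simp only [ridge, auxE, sub_mulVec, one_mulVec, mulVec_mulVec]

theorem aux_RSS {n k : ℕ} (X : Matrix (Fin n) (Fin k) ℝ)
    (Φ : Matrix (Fin n) (Fin n) ℝ) (K : Matrix (Fin k) (Fin k) ℝ) (y : Fin n → ℝ) :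
    RSS X Φ K y = y ⬝ᵥ ((auxE X Φ⁻¹ K)ᵀ * Φ⁻¹ * auxE X Φ⁻¹ K) *ᵥ y := by
  rw [RSS, aux_resid, mul_assoc, ← mulVec_mulVec, ← mulVec_mulVec, dotProduct_mulVec y,
    vecMul_transpose]

theorem aux_Q {n k : ℕ} (X : Matrix (Fin n) (Fin k) ℝ) (hX : X.rank = k)
    (W : Matrix (Fin n) (Fin n) ℝ) (hW : W.PosDef)
    (K : Matrix (Fin k) (Fin k) ℝ) (hK : K.PosDef) :
    ((auxE X W K)ᵀ * W * auxE X W K)ᵀ = (auxE X W K)ᵀ * W * auxE X W K ∧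
    (∃ C : Matrix (Fin k) (Fin k) ℝ, IsUnit C.det ∧
      (auxE X W K)ᵀ * W * auxE X W K * X = W * X * C) ∧
    ∀ R : Matrix (Fin n) (Fin n) ℝ, Xᵀ * W * R = 0 →
      (auxE X W K)ᵀ * W * auxE X W K * R = W * R := by
  have hWt : Wᵀ = W := by
    have := hW.1.eq
    rwa [conjTranspose_eq_transpose_of_trivial] at this
  have hAK : (Xᵀ * W * X + K).PosDef := (aux_posDef X hX W hW).add hK
  have hAKt : (Xᵀ * W * X + K)ᵀ = Xᵀ * W * X + K := by
    have := hAK.1.eq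
    rwa [conjTranspose_eq_transpose_of_trivial] at this
  have hAKu : IsUnit (Xᵀ * W * X + K).det := hAK.det_pos.ne'.isUnit
  have hKu : IsUnit K.det := hK.det_pos.ne'.isUnit
  obtain ⟨M, hM⟩ : ∃ M, M = (Xᵀ * W * X + K)⁻¹ := ⟨_, rfl⟩
  have hMt : Mᵀ = M := by rw [hM, transpose_nonsing_inv, hAKt]
  have hM1 : M * (Xᵀ * W * X + K) = 1 := by rw [hM]; exact nonsing_inv_mul _ hAKu
  have hMK : M * K = 1 - M * (Xᵀ * W * X) := by
    rw [← hM1, mul_add]; abel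
  have hMu : IsUnit M.det := by rw [hM]; exact isUnit_nonsing_inv_det _ hAKu
  have hE : auxE X W K = 1 - X * (M * Xᵀ * W) := by rw [auxE, hM]
  have hEt : (auxE X W K)ᵀ = 1 - W * X * M * Xᵀ := by
    rw [hE]
    simp only [transpose_sub, transpose_one, transpose_mul, transpose_transpose, hMt, hWt,
      Matrix.mul_assoc]
  have hEX : auxE X W K * X = X * (M * K) := by
    rw [hE, hMK]
    simp only [Matrix.sub_mul, Matrix.mul_sub, Matrix.one_mul, Matrix.mul_one, Matrix.mul_assoc]
  have hEWX : (auxE X W K)ᵀ * W * X = W * X * (M * K) := by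
    rw [hEt, hMK]
    simp only [Matrix.sub_mul, Matrix.mul_sub, Matrix.one_mul, Matrix.mul_one, Matrix.mul_assoc]
  refine ⟨?_, ⟨M * K * (M * K), ?_, ?_⟩, ?_⟩
  · simp only [transpose_mul, transpose_transpose, hWt, Matrix.mul_assoc]
  · simp only [det_mul]
    exact (hMu.mul hKu).mul (hMu.mul hKu)
  · rw [Matrix.mul_assoc _ _ X, hEX, ← Matrix.mul_assoc, hEWX]
    simp only [Matrix.mul_assoc]
  · intro R hR
    have hR' : Xᵀ * (W * R) = 0 := by rw [← Matrix.mul_assoc, hR]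
    have h1 : auxE X W K * R = R := by
      rw [hE]
      simp only [Matrix.sub_mul, Matrix.one_mul, Matrix.mul_assoc, hR', Matrix.mul_zero, sub_zero]
    rw [Matrix.mul_assoc _ _ R, h1, hEt]
    simp only [Matrix.sub_mul, Matrix.one_mul, Matrix.mul_assoc, hR', Matrix.mul_zero, sub_zero]

theorem stmt_13 (n k : ℕ) (hk : 0 < k) (hn : k < n)
    (X : Matrix (Fin n) (Fin k) ℝ) (hX : X.rank = k)
    (Z : Matrix (Fin n) (Fin (n - k)) ℝ) (hXZ : Xᵀ * Z = 0) (hZ : Z.rank = n - k)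
    (Ω : Matrix (Fin n) (Fin n) ℝ) (hΩ : Ω.PosDef)
    (K₁ K₂ : Matrix (Fin k) (Fin k) ℝ) (hK₁ : K₁.PosDef) (hK₂ : K₂.PosDef)
    (h : ∀ y : Fin n → ℝ, RSS X Ω K₁ y = RSS X 1 K₂ y) :
    ∀ y : Fin n → ℝ, ridge X Ω 0 y = ridge X 1 0 y ∧ RSS X Ω 0 y = RSS X 1 0 y := by
  
  have hW : (Ω⁻¹).PosDef := hΩ.inv
  have h1 : ((1 : Matrix (Fin n) (Fin n) ℝ)⁻¹) = 1 := inv_one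
  obtain ⟨s1, ⟨C, hC, hCX⟩, hR1⟩ := aux_Q X hX Ω⁻¹ hW K₁ hK₁
  obtain ⟨s2, ⟨D, hD, hDX⟩, hR2⟩ := aux_Q X hX 1 PosDef.one K₂ hK₂
  have hQ : (auxE X Ω⁻¹ K₁)ᵀ * Ω⁻¹ * auxE X Ω⁻¹ K₁ = (auxE X 1 K₂)ᵀ * 1 * auxE X 1 K₂ := by
    rw [← sub_eq_zero]
    apply aux_symm_zero
    · rw [transpose_sub, s1, s2]
    · intro y
      have := h y
      rw [aux_RSS, aux_RSS, h1] at this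
      rw [sub_mulVec, dotProduct_sub, this, sub_self]
  have hA : (Xᵀ * Ω⁻¹ * X).PosDef := aux_posDef X hX _ hW
  have hB : (Xᵀ * X).PosDef := by simpa using aux_posDef X hX 1 PosDef.one
  have hAu : IsUnit (Xᵀ * Ω⁻¹ * X).det := hA.det_pos.ne'.isUnit
  have hBu : IsUnit (Xᵀ * X).det := hB.det_pos.ne'.isUnit
  have hWt : (Ω⁻¹)ᵀ = Ω⁻¹ := by
    have := hW.1.eq
    rwa [conjTranspose_eq_transpose_of_trivial] at this
  obtain ⟨G, hG⟩ : ∃ G : Matrix (Fin k) (Fin k) ℝ, Ω⁻¹ * X = X * G := by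
    refine ⟨D * C⁻¹, ?_⟩
    have h3 : Ω⁻¹ * X * C = X * D := by rw [← hCX, hQ, hDX, Matrix.one_mul]
    rw [← Matrix.mul_assoc, ← h3, Matrix.mul_nonsing_inv_cancel_right _ _ hC]
  have hGt : Xᵀ * Ω⁻¹ = Gᵀ * Xᵀ := by
    have := congrArg transpose hG
    rwa [transpose_mul, transpose_mul, hWt] at this
  have hbeta : (Xᵀ * Ω⁻¹ * X)⁻¹ * Xᵀ * Ω⁻¹ = (Xᵀ * X)⁻¹ * Xᵀ := by
    have h4 : Xᵀ * Ω⁻¹ = (Xᵀ * Ω⁻¹ * X) * ((Xᵀ * X)⁻¹ * Xᵀ) := by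
      rw [hGt, Matrix.mul_assoc Gᵀ, Matrix.mul_assoc Gᵀ, ← Matrix.mul_assoc (Xᵀ * X),
        mul_nonsing_inv _ hBu, Matrix.one_mul]
    rw [Matrix.mul_assoc _ Xᵀ, h4, ← h4]
    nth_rewrite 2 [h4]
    rw [nonsing_inv_mul_cancel_left _ _ hAu]
  have hr : ∀ y, ridge X Ω 0 y = ridge X 1 0 y := by
    intro y
    simp only [ridge, add_zero, h1, Matrix.mul_one, hbeta]
  intro y
  refine ⟨hr y, ?_⟩
  have hXR : Xᵀ * auxE X 1 0 = 0 := by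
    simp only [auxE, add_zero, Matrix.mul_one, Matrix.mul_sub]
    rw [← Matrix.mul_assoc, ← Matrix.mul_assoc, mul_nonsing_inv _ hBu, Matrix.one_mul, sub_self]
  have hWR : Ω⁻¹ * auxE X 1 0 = auxE X 1 0 := by
    rw [← hR1 (auxE X 1 0) (by rw [hGt, Matrix.mul_assoc, hXR, Matrix.mul_zero]), hQ,
      hR2 (auxE X 1 0) (by rw [Matrix.mul_one, hXR]), Matrix.one_mul]
  rw [RSS, RSS, hr y, aux_resid, h1, mulVec_mulVec, hWR, one_mulVec]
end

section
/- Suppose Ω = XΓXᵀ + ZΔZᵀ, where Γ is a real k×k symmetric positive definite matrix and Δ is a real (n−k)×(n−k) symmetric positive definite matrix. Then Ω⁻¹ = X(XᵀX)⁻¹Γ⁻¹(XᵀX)⁻¹Xᵀ + Z(ZᵀZ)⁻¹Δ⁻¹(ZᵀZ)⁻¹Zᵀ, and consequently Ω⁻¹X = X(ΓXᵀX)⁻¹. -/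
open Matrix

theorem aux_isUnit {m : ℕ} (A : Matrix (Fin m) (Fin m) ℝ) (h : A.rank = m) : IsUnit A.det := by
  rw [← Matrix.isUnit_iff_isUnit_det, ← Matrix.mulVec_surjective_iff_isUnit]
  have : LinearMap.range A.mulVecLin = ⊤ := by
    apply Submodule.eq_top_of_finrank_eq
    rw [Matrix.rank] at h
    simpa using h
  exact LinearMap.range_eq_top.mp this

theorem stmt_15 (n k : ℕ) (hk : 0 < k) (hn : k < n)
    (X : Matrix (Fin n) (Fin k) ℝ) (hX : X.rank = k)
    (Z : Matrix (Fin n) (Fin (n - k)) ℝ) (hXZ : Xᵀ * Z = 0) (hZ : Z.rank = n - k)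
    (Ω : Matrix (Fin n) (Fin n) ℝ) (hΩ : Ω.PosDef)
    (Γ : Matrix (Fin k) (Fin k) ℝ) (hΓ : Γ.PosDef)
    (Δ : Matrix (Fin (n - k)) (Fin (n - k)) ℝ) (hΔ : Δ.PosDef)
    (hrep : Ω = X * Γ * Xᵀ + Z * Δ * Zᵀ) :
    Ω⁻¹ = X * (Xᵀ * X)⁻¹ * Γ⁻¹ * (Xᵀ * X)⁻¹ * Xᵀ
        + Z * (Zᵀ * Z)⁻¹ * Δ⁻¹ * (Zᵀ * Z)⁻¹ * Zᵀ ∧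
      Ω⁻¹ * X = X * (Γ * (Xᵀ * X))⁻¹ := by
  have hA : IsUnit (Xᵀ * X).det := aux_isUnit _ (by rw [rank_transpose_mul_self, hX])
  have hB : IsUnit (Zᵀ * Z).det := aux_isUnit _ (by rw [rank_transpose_mul_self, hZ])
  have hG : IsUnit Γ.det := hΓ.det_pos.ne'.isUnit
  have hD : IsUnit Δ.det := hΔ.det_pos.ne'.isUnit
  have hO : IsUnit Ω.det := hΩ.det_pos.ne'.isUnit
  have hZX : Zᵀ * X = 0 := by
    have := congrArg Matrix.transpose hXZ
    simpa using this
  have a1 : ∀ M : Matrix (Fin k) (Fin n) ℝ, (Xᵀ * X)⁻¹ * (Xᵀ * (X * M)) = M := fun M => by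
    rw [← Matrix.mul_assoc Xᵀ, Matrix.nonsing_inv_mul_cancel_left _ _ hA]
  have b1 : ∀ M : Matrix (Fin (n - k)) (Fin n) ℝ, (Zᵀ * Z)⁻¹ * (Zᵀ * (Z * M)) = M := fun M => by
    rw [← Matrix.mul_assoc Zᵀ, Matrix.nonsing_inv_mul_cancel_left _ _ hB]
  have a2 : ∀ M : Matrix (Fin (n - k)) (Fin n) ℝ, Xᵀ * (Z * M) = 0 := fun M => by
    rw [← Matrix.mul_assoc, hXZ, Matrix.zero_mul]
  have b2 : ∀ M : Matrix (Fin k) (Fin n) ℝ, Zᵀ * (X * M) = 0 := fun M => by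
    rw [← Matrix.mul_assoc, hZX, Matrix.zero_mul]
  have g1 : ∀ M : Matrix (Fin k) (Fin n) ℝ, Γ⁻¹ * (Γ * M) = M := fun M =>
    Matrix.nonsing_inv_mul_cancel_left _ _ hG
  have d1 : ∀ M : Matrix (Fin (n - k)) (Fin n) ℝ, Δ⁻¹ * (Δ * M) = M := fun M =>
    Matrix.nonsing_inv_mul_cancel_left _ _ hD
  have hP : X * ((Xᵀ * X)⁻¹ * Xᵀ) + Z * ((Zᵀ * Z)⁻¹ * Zᵀ) = 1 := by
    have h : (X * ((Xᵀ * X)⁻¹ * Xᵀ) + Z * ((Zᵀ * Z)⁻¹ * Zᵀ)) * Ω = Ω := by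
      rw [hrep]
      simp only [Matrix.add_mul, Matrix.mul_add, Matrix.mul_assoc, a1, a2, b1, b2,
        Matrix.mul_zero, add_zero, zero_add]
    calc _ = (X * ((Xᵀ * X)⁻¹ * Xᵀ) + Z * ((Zᵀ * Z)⁻¹ * Zᵀ)) * Ω * Ω⁻¹ :=
          (Matrix.mul_nonsing_inv_cancel_right _ _ hO).symm
      _ = 1 := by rw [h, Matrix.mul_nonsing_inv _ hO]
  constructor
  · apply Matrix.inv_eq_left_inv
    rw [← hP, hrep]
    simp only [Matrix.add_mul, Matrix.mul_add, Matrix.mul_assoc, a1, a2, b1, b2, g1, d1,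
        Matrix.mul_zero, add_zero, zero_add]
  · have hGA : IsUnit (Γ * (Xᵀ * X)).det := by
      rw [Matrix.det_mul]; exact hG.mul hA
    have h0 : Ω * X = X * (Γ * (Xᵀ * X)) := by
      rw [hrep]
      simp only [Matrix.add_mul, Matrix.mul_assoc, hZX, Matrix.mul_zero, add_zero]
    have h : Ω * (X * (Γ * (Xᵀ * X))⁻¹) = X := by
      rw [← Matrix.mul_assoc, h0, Matrix.mul_nonsing_inv_cancel_right _ _ hGA]
    calc Ω⁻¹ * X = Ω⁻¹ * (Ω * (X * (Γ * (Xᵀ * X))⁻¹)) := by rw [h]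
      _ = _ := Matrix.nonsing_inv_mul_cancel_left _ _ hO
end
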